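/- Let G = (V,E) be a finite graph and T ⊆ V a nonempty subset of even cardinality. Then the linear system { x(J) ≥ 1 for every T-join J ; x ≥ 0 } in variables x ∈ ℝ^E is totally dual dyadic: for every w ∈ ℤ^E for which the linear program min{wᵀx : x(J) ≥ 1 for all T-joins J, x ≥ 0} has an optimal solution, the dual linear program max{1ᵀy : Σ_{J : e ∈ J} y_J ≤ w_e for all e ∈ E, y ≥ 0} (with one variable y_J ≥ 0 per T-join J) has an optimal solution all of whose entries are dyadic rationals. -/

import Mathlib

open Finset

attribute [local instance] Classical.propDecidable

/-- A real number is dyadic if it has the form `a / 2^k` for integers `a, k`, `k ≥ 0`. -/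
def IsDyadic (r : ℝ) : Prop := ∃ (a : ℤ) (k : ℕ), r = (a : ℝ) / (2 : ℝ) ^ k

/-- In the multigraph with edge set `E` and endpoint map `ends`, `J` is a `T`-join if the
set of vertices of odd degree in the subgraph formed by `J` is exactly `T`. -/
def IsTJoin {V E : Type} [Fintype V] [Fintype E] (ends : E → Sym2 V) (T : Finset V)
    (J : Finset E) : Prop :=
  ∀ v : V, (Odd ((Finset.univ.filter (fun e => e ∈ J ∧ v ∈ ends e)).card) ↔ v ∈ T)

section TJAux

/-- two disjoint link relations cannot both be connected -/
theorem tj_disc_step {α : Type} [DecidableEq α] (f g : α → α → Prop) (W : Finset α)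
    (sf : ∀ x y, f x y → f y x) (sg : ∀ x y, g x y → g y x)
    (rb : ∀ x ∈ W, ∀ y ∈ W, ∀ z ∈ W, x ≠ y → y ≠ z → x ≠ z → f x y → g y z → f x z ∨ g x z)
    (dis : ∀ x ∈ W, ∀ y ∈ W, x ≠ y → f x y → g x y → False)
    (alt : ∀ v ∈ W, ∀ t ∈ W, ∀ s ∈ W, ∀ h ∈ W, v ≠ t → v ≠ s → v ≠ h → t ≠ s → t ≠ h → s ≠ h →
      g v t → f t s → g s h → f h v → f v s → g t h → False)
    (A' : Finset α) (v : α) (hv : v ∈ W) (hvA : v ∉ A') (hA : A' ⊆ W)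
    (B : Finset α) (hB : B ⊆ A') (hB1 : B.Nonempty) (hB2 : (A' \ B).Nonempty)
    (hno : ∀ x ∈ B, ∀ y ∈ A' \ B, ¬ f x y) :
    ∃ B ⊆ insert v A', B.Nonempty ∧ (insert v A' \ B).Nonempty ∧
      ((∀ x ∈ B, ∀ y ∈ insert v A' \ B, ¬ f x y) ∨ (∀ x ∈ B, ∀ y ∈ insert v A' \ B, ¬ g x y)) := by
  classical
  by_contra hcon
  push Not at hcon
  -- main argument for a partition
  have main : ∀ B1 B2 : Finset α, B1 ⊆ A' → B2 ⊆ A' → (∀ x ∈ A', x ∈ B1 ∨ x ∈ B2) →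
      B2.Nonempty → Disjoint B1 B2 →
      (∀ x ∈ B1, ∀ y ∈ B2, ¬ f x y) → ∀ q ∈ B1, g v q → False := by
    intro B1 B2 h1 h2 h12 hne hd hno q hq hgq
    -- h in B2
    have hv2 : v ∉ B2 := fun h => hvA (h2 h)
    have hv1 : v ∉ B1 := fun h => hvA (h1 h)
    have d12 : ∀ x, x ∈ B1 → x ∈ B2 → False := fun x hx hy =>
      (Finset.disjoint_left.mp hd) hx hy
    obtain ⟨⟨h, hh, y, hy, hfy⟩, -⟩ := hcon B2 (h2.trans (Finset.subset_insert _ _)) hne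
      ⟨v, by simp [hv2]⟩
    have hyv : y = v := by
      simp only [Finset.mem_sdiff, Finset.mem_insert] at hy
      rcases hy.1 with r | r
      · exact r
      · rcases h12 y r with r | r
        · exact absurd (sf _ _ hfy) (hno y r h hh)
        · exact absurd r hy.2
    subst hyv
    obtain ⟨⟨tt, htt, z, hz, hfz⟩, -⟩ := hcon (B1.filter (fun x => g y x))
      ((Finset.filter_subset _ _).trans (h1.trans (Finset.subset_insert _ _)))
      ⟨q, by simp [hq, hgq]⟩ ⟨y, by simp [hv1]⟩
    simp only [Finset.mem_filter] at htt
    simp only [Finset.mem_sdiff, Finset.mem_insert, Finset.mem_filter, not_and] at hz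
    have httW := hA (h1 htt.1)
    have hhW := hA (h2 hh)
    have nyt : y ≠ tt := fun e => hv1 (e ▸ htt.1)
    have nyh : y ≠ h := fun e => hv2 (e ▸ hh)
    have nth : tt ≠ h := fun e => d12 _ htt.1 (e ▸ hh)
    have hzy : z ≠ y := by
      rintro rfl
      exact dis _ httW _ hv nyt.symm hfz (sg _ _ htt.2)
    have hzA : z ∈ A' := hz.1.resolve_left hzy
    have hzW := hA hzA
    have hz1 : z ∈ B1 := by
      rcases h12 z hzA with r | r
      · exact r
      · exact absurd hfz (hno _ htt.1 _ r)
    have hgz := hz.2 hz1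
    have ntz : tt ≠ z := by
      rintro rfl; exact hgz htt.2
    have nzh : z ≠ h := fun e => d12 _ hz1 (e ▸ hh)
    have fyz : f y z := by
      rcases rb z hzW tt httW y hv ntz.symm nyt.symm hzy (sf _ _ hfz) (sg _ _ htt.2) with r | r
      · exact sf _ _ r
      · exact absurd (sg _ _ r) hgz
    have gth : g tt h := by
      rcases rb h hhW y hv tt httW nyh.symm nyt nth.symm hfy htt.2 with r | r
      · exact absurd (sf _ _ r) (hno _ htt.1 _ hh)
      · exact sg _ _ r
    have gzh : g z h := by
      rcases rb z hzW tt httW h hhW ntz.symm nth nzh (sf _ _ hfz) gth with r | r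
      · exact absurd r (hno _ hz1 _ hh)
      · exact r
    exact alt y hv tt httW z hzW h hhW nyt hzy.symm nyh ntz nth nzh htt.2 hfz gzh hfy fyz gth
  obtain ⟨-, x, hx, y, hy, hgy⟩ := hcon {v} (by simp) (by simp) (by
    obtain ⟨b, hb⟩ := hB1
    exact ⟨b, by simp [hB hb]; rintro rfl; exact hvA (hB hb)⟩)
  simp only [Finset.mem_singleton] at hx
  subst hx
  simp only [Finset.mem_sdiff, Finset.mem_insert, Finset.mem_singleton] at hy
  have hyA := hy.1.resolve_left hy.2
  by_cases hyB : y ∈ B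
  · refine main B (A' \ B) hB Finset.sdiff_subset (fun x hx => ?_) hB2 Finset.disjoint_sdiff hno y hyB hgy
    simp [hx, em]
  · refine main (A' \ B) B Finset.sdiff_subset hB (fun x hx => ?_) hB1 Finset.sdiff_disjoint
      (fun x hx y hy h => hno y hy x hx (sf _ _ h)) y (by simp [hyA, hyB]) hgy
    simp [hx, em']

theorem tj_disc {α : Type} [DecidableEq α] (f g : α → α → Prop) (W : Finset α)
    (sf : ∀ x y, f x y → f y x) (sg : ∀ x y, g x y → g y x)
    (rb : ∀ x ∈ W, ∀ y ∈ W, ∀ z ∈ W, x ≠ y → y ≠ z → x ≠ z → f x y → g y z → f x z ∨ g x z)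
    (dis : ∀ x ∈ W, ∀ y ∈ W, x ≠ y → f x y → g x y → False)
    (alt : ∀ v ∈ W, ∀ t ∈ W, ∀ s ∈ W, ∀ h ∈ W, v ≠ t → v ≠ s → v ≠ h → t ≠ s → t ≠ h → s ≠ h →
      g v t → f t s → g s h → f h v → f v s → g t h → False)
    (A : Finset α) (hA : A ⊆ W) (h2 : 2 ≤ A.card) :
    ∃ B ⊆ A, B.Nonempty ∧ (A \ B).Nonempty ∧
      ((∀ x ∈ B, ∀ y ∈ A \ B, ¬ f x y) ∨ (∀ x ∈ B, ∀ y ∈ A \ B, ¬ g x y)) := by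
  classical
  induction A using Finset.induction_on with
  | empty => simp at h2
  | insert v A' hv ih =>
    have hvW : v ∈ W := hA (by simp)
    have hA' : A' ⊆ W := (Finset.subset_insert _ _).trans hA
    rw [Finset.card_insert_of_notMem hv] at h2
    by_cases h1 : A'.card = 1
    · obtain ⟨u, rfl⟩ := Finset.card_eq_one.mp h1
      have hvu : v ≠ u := by simpa using hv
      have huW : u ∈ W := hA' (by simp)
      refine ⟨{v}, by simp, by simp, ⟨u, by simp [hvu.symm]⟩, ?_⟩
      by_cases hf : f v u
      · right
        intro x hx y hy hg
        simp only [Finset.mem_sdiff, Finset.mem_insert, Finset.mem_singleton] at hx hy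
        subst hx
        rcases hy.1 with r | r
        · exact hy.2 r
        · subst r; exact dis _ hvW _ huW hvu hf hg
      · left
        intro x hx y hy hg
        simp only [Finset.mem_sdiff, Finset.mem_insert, Finset.mem_singleton] at hx hy
        subst hx
        rcases hy.1 with r | r
        · exact hy.2 r
        · subst r; exact hf hg
    · obtain ⟨B, hB, hB1, hB2, hno | hno⟩ := ih hA' (by omega)
      · exact tj_disc_step f g W sf sg rb dis alt A' v hvW hv hA' B hB hB1 hB2 hno
      · obtain ⟨B', a1, a2, a3, a4⟩ := tj_disc_step g f W sg sf
          (fun x hx y hy z hz n1 n2 n3 h h' =>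
            ((rb z hz y hy x hx n2.symm n1.symm n3.symm (sf _ _ h') (sg _ _ h)).imp
              (sf _ _) (sg _ _)).symm)
          (fun x hx y hy n h h' => dis x hx y hy n h' h)
          (fun v hv t ht s hs h hh n1 n2 n3 n4 n5 n6 e1 e2 e3 e4 e5 e6 =>
            alt h hh v hv t ht s hs n3.symm n5.symm n6.symm n1 n2 n4
              e4 e1 e2 e3 (sf _ _ e6) e5)
          A' v hvW hv hA' B hB hB1 hB2 hno
        exact ⟨B', a1, a2, a3, a4.symm⟩

end TJAux

section TJComb

/-- exchange property for a set system -/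
def TJExch {α : Type} [DecidableEq α] (F : Finset α → Prop) : Prop :=
  ∀ X Y, F X → F Y → ∀ x ∈ symmDiff X Y, ∃ y ∈ symmDiff X Y, y ≠ x ∧ F (symmDiff X {x, y})

theorem tj_cover {α : Type} [DecidableEq α] {F : Finset α → Prop} (hF : TJExch F)
    {K : Finset α} (hK : F K) (h1 : ∀ a ∈ K, F {a}) {a b : α} (ha : a ∈ K) (hb : b ∈ K)
    (hab : a ≠ b) : ∃ c ∈ K, c ≠ a ∧ c ≠ b ∧ F {a, b, c} := by
  obtain ⟨y, hy, hyb, h⟩ := hF {a} K (h1 a ha) hK b (by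
    simp [Finset.mem_symmDiff, hb, hab.symm])
  simp only [Finset.mem_symmDiff, Finset.mem_singleton] at hy
  have hya : y ≠ a := by rintro rfl; tauto
  have hyK : y ∈ K := by tauto
  refine ⟨y, hyK, hya, hyb, ?_⟩
  convert h using 1
  ext e
  simp only [Finset.mem_symmDiff, Finset.mem_singleton, Finset.mem_insert]
  grind

theorem tj_four {α : Type} [DecidableEq α] {F : Finset α → Prop} (hF : TJExch F)
    {a b c d : α} (hab : a ≠ b) (hac : a ≠ c) (hbc : b ≠ c) (had : a ≠ d) (hbd : b ≠ d)
    (hcd : c ≠ d) (h : F {a, b, c}) (hd : F {d}) :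
    F {b, c, d} ∨ F {a, c, d} ∨ F {a, b, d} := by
  obtain ⟨y, hy, hyd, h'⟩ := hF _ _ h hd d (by
    simp [Finset.mem_symmDiff, had.symm, hbd.symm, hcd.symm])
  simp only [Finset.mem_symmDiff, Finset.mem_singleton, Finset.mem_insert] at hy
  have : y = a ∨ y = b ∨ y = c := by tauto
  rcases this with rfl | rfl | rfl
  · left
    convert h' using 1
    ext e; simp only [Finset.mem_symmDiff, Finset.mem_singleton, Finset.mem_insert]; grind
  · right; left
    convert h' using 1
    ext e; simp only [Finset.mem_symmDiff, Finset.mem_singleton, Finset.mem_insert]; grind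
  · right; right
    convert h' using 1
    ext e; simp only [Finset.mem_symmDiff, Finset.mem_singleton, Finset.mem_insert]; grind

theorem tj_s1 {α : Type} [DecidableEq α] (a b c : α) : ({a, b, c} : Finset α) = {b, a, c} := by
  ext; simp only [Finset.mem_singleton, Finset.mem_insert]; tauto
theorem tj_s2 {α : Type} [DecidableEq α] (a b c : α) : ({a, b, c} : Finset α) = {a, c, b} := by
  ext; simp only [Finset.mem_singleton, Finset.mem_insert]; tauto
theorem tj_s3 {α : Type} [DecidableEq α] (a b c : α) : ({a, b, c} : Finset α) = {c, a, b} := by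
  ext; simp only [Finset.mem_singleton, Finset.mem_insert]; tauto

theorem tj_rb {α : Type} [DecidableEq α] {F G : Finset α → Prop} (hF : TJExch F) (hG : TJExch G)
    {K : Finset α} (h1 : ∀ a ∈ K, F {a}) (g1 : ∀ a ∈ K, G {a})
    (h3 : ∀ a ∈ K, ∀ b ∈ K, ∀ c ∈ K, a ≠ b → a ≠ c → b ≠ c → F {a, b, c} → G {a, b, c} → False)
    {r x y z : α} (hr : r ∈ K) (hx : x ∈ K) (hy : y ∈ K) (hz : z ∈ K)
    (rx : r ≠ x) (ry : r ≠ y) (rz : r ≠ z) (xy : x ≠ y) (yz : y ≠ z) (xz : x ≠ z)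
    (f : F {r, x, y}) (g : G {r, y, z}) : F {r, x, z} ∨ G {r, x, z} := by
  rcases tj_four hF rx ry xy rz xz yz f (h1 z hz) with a | a | a
  · rcases tj_four hG ry rz yz rx xy.symm xz.symm g (g1 x hx) with b | b | b
    · rw [tj_s3] at b
      exact (h3 x hx y hy z hz xy xz yz a b).elim
    · rw [tj_s2] at b; exact Or.inr b
    · rw [tj_s2] at b; exact (h3 _ hr _ hx _ hy rx ry xy f b).elim
  · exact (h3 _ hr _ hy _ hz ry rz yz a g).elim
  · exact Or.inl a

theorem tj_core {α : Type} [DecidableEq α] {F G : Finset α → Prop} (hF : TJExch F) (hG : TJExch G)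
    {K : Finset α} (hK : F K) (h1 : ∀ a ∈ K, F {a}) (g1 : ∀ a ∈ K, G {a})
    (h3 : ∀ a ∈ K, ∀ b ∈ K, ∀ c ∈ K, a ≠ b → a ≠ c → b ≠ c → F {a, b, c} → G {a, b, c} → False)
    {r : α} (hr : r ∈ K) {A : Finset α} (hA : A ⊆ K.erase r)
    (hM : ∀ w ∈ K.erase r, w ∉ A → ∀ x ∈ A, ∀ y ∈ A, F {r, x, w} → G {r, y, w} → False)
    (hno : ∀ x ∈ A, ∀ y ∈ A, x ≠ y → ¬ F {r, x, y})
    {x y : α} (hx : x ∈ A) (hy : y ∈ A) (xy : x ≠ y) (g : G {r, x, y}) : False := by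
  have hx' := Finset.mem_erase.mp (hA hx)
  have hy' := Finset.mem_erase.mp (hA hy)
  obtain ⟨z, hz, zx, zy, f⟩ := tj_cover hF hK h1 hx'.2 hy'.2 xy
  have zr : z ≠ r := by
    rintro rfl
    rw [tj_s3] at f
    exact hno _ hx _ hy xy f
  have hg := tj_four hG hx'.1.symm hy'.1.symm xy zr.symm zx.symm zy.symm g (g1 z hz)
  have hf := tj_four hF xy zx.symm zy.symm hx'.1 hy'.1 zr f (h1 r hr)
  have nb : ∀ v ∈ A, v ≠ z → F {r, v, z} → z ∉ A := fun v hv vz h hzA => hno v hv z hzA vz h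
  have hzW : z ∈ K.erase r := Finset.mem_erase.mpr ⟨zr, hz⟩
  rcases hg with b | b | b
  · exact h3 _ hx'.2 _ hy'.2 _ hz xy zx.symm zy.symm f b
  · rcases hf with a | a | a
    · rw [tj_s3] at a
      exact h3 _ hr _ hy'.2 _ hz hy'.1.symm zr.symm zy.symm a b
    · rw [tj_s3] at a
      exact hM z hzW (nb _ hx zx.symm a) x hx y hy a b
    · rw [tj_s3] at a
      exact hno _ hx _ hy xy a
  · rcases hf with a | a | a
    · rw [tj_s3] at a
      exact hM z hzW (nb _ hy zy.symm a) y hy x hx a b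
    · rw [tj_s3] at a
      exact h3 _ hr _ hx'.2 _ hz hx'.1.symm zr.symm zx.symm a b
    · rw [tj_s3] at a
      exact hno _ hx _ hy xy a

theorem tj_alt {α : Type} [DecidableEq α] {F : Finset α → Prop} (hF : TJExch F)
    {r v t s h : α} (rv : r ≠ v) (rt : r ≠ t) (rs : r ≠ s) (rh : r ≠ h)
    (vt : v ≠ t) (vs : v ≠ s) (vh : v ≠ h) (ts : t ≠ s) (th : t ≠ h) (sh : s ≠ h)
    (f1 : F {r, t, s}) (f2 : F {r, h, v}) (n1 : ¬ F {r, s, h}) (n2 : ¬ F {r, t, h}) :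
    F {r, v, t, s, h} := by
  obtain ⟨y, hy, hyd, h'⟩ := hF _ _ f1 f2 h (by
    simp only [Finset.mem_symmDiff, Finset.mem_singleton, Finset.mem_insert]; grind)
  simp only [Finset.mem_symmDiff, Finset.mem_singleton, Finset.mem_insert] at hy
  have : y = t ∨ y = s ∨ y = v := by grind
  rcases this with rfl | rfl | rfl
  · exfalso; apply n1
    convert h' using 1
    ext e; simp only [Finset.mem_symmDiff, Finset.mem_singleton, Finset.mem_insert]; grind
  · exfalso; apply n2
    convert h' using 1
    ext e; simp only [Finset.mem_symmDiff, Finset.mem_singleton, Finset.mem_insert]; grind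
  · convert h' using 1
    ext e; simp only [Finset.mem_symmDiff, Finset.mem_singleton, Finset.mem_insert]; grind

theorem tj_comb {α : Type} [DecidableEq α] {F G : Finset α → Prop} (hF : TJExch F) (hG : TJExch G)
    {K : Finset α} (hK : F K) (gK : G K) (h1 : ∀ a ∈ K, F {a}) (g1 : ∀ a ∈ K, G {a})
    (hc : 2 ≤ K.card) :
    ∃ X ⊆ K, (X.card = 3 ∨ X.card = 5) ∧ F X ∧ G X := by
  classical
  by_contra hcon
  push Not at hcon
  have h3 : ∀ a ∈ K, ∀ b ∈ K, ∀ c ∈ K, a ≠ b → a ≠ c → b ≠ c →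
      F {a, b, c} → G {a, b, c} → False := by
    intro a ha b hb c hc ab ac bc f g
    refine hcon {a, b, c} ?_ (Or.inl ?_) f g
    · intro e he; simp only [Finset.mem_singleton, Finset.mem_insert] at he; grind
    · rw [Finset.card_eq_three]; exact ⟨a, b, c, ab, ac, bc, rfl⟩
  obtain ⟨r, hr⟩ : K.Nonempty := Finset.card_pos.mp (by omega)
  have hdisc := tj_disc (fun x y => F {r, x, y}) (fun x y => G {r, x, y}) (K.erase r)
    (fun x y h => by rw [tj_s2]; exact h) (fun x y h => by rw [tj_s2]; exact h)
    (fun x hx y hy z hz xy yz xz f g => by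
      rw [Finset.mem_erase] at hx hy hz
      exact tj_rb hF hG h1 g1 h3 hr hx.2 hy.2 hz.2 hx.1.symm hy.1.symm hz.1.symm xy yz xz f g)
    (fun x hx y hy xy f g => by
      rw [Finset.mem_erase] at hx hy
      exact h3 r hr x hx.2 y hy.2 hx.1.symm hy.1.symm xy f g)
    (fun v hv t ht s hs h hh vt vs vh ts th sh gvt fts gsh fhv fvs gth => by
      rw [Finset.mem_erase] at hv ht hs hh
      have F5 := tj_alt hF hv.1.symm ht.1.symm hs.1.symm hh.1.symm vt vs vh ts th sh fts fhv
        (fun q => h3 r hr s hs.2 h hh.2 hs.1.symm hh.1.symm sh q gsh)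
        (fun q => h3 r hr t ht.2 h hh.2 ht.1.symm hh.1.symm th q gth)
      have G5 := tj_alt hG hh.1.symm hv.1.symm ht.1.symm hs.1.symm
        vh.symm th.symm sh.symm vt vs ts gvt gsh
        (fun q => h3 r hr t ht.2 s hs.2 ht.1.symm hs.1.symm ts fts q)
        (fun q => h3 r hr v hv.2 s hs.2 hv.1.symm hs.1.symm vs fvs q)
      have e5 : ({r, h, v, t, s} : Finset α) = {r, v, t, s, h} := by
        ext; simp only [Finset.mem_singleton, Finset.mem_insert]; tauto
      rw [e5] at G5
      refine hcon {r, v, t, s, h} ?_ (Or.inr ?_) F5 G5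
      · intro e he; simp only [Finset.mem_singleton, Finset.mem_insert] at he; grind
      · rw [Finset.card_insert_of_notMem, Finset.card_insert_of_notMem,
          Finset.card_insert_of_notMem, Finset.card_insert_of_notMem, Finset.card_singleton] <;>
          simp only [Finset.mem_singleton, Finset.mem_insert] <;> grind)
  -- minimal module
  let P : Finset α → Prop := fun A => A ⊆ K.erase r ∧
    (∃ x ∈ A, ∃ y ∈ A, x ≠ y ∧ (F {r, x, y} ∨ G {r, x, y})) ∧
    (∀ w ∈ K.erase r, w ∉ A → ∀ x ∈ A, ∀ y ∈ A, F {r, x, w} → G {r, y, w} → False)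
  have hPW : P (K.erase r) := by
    refine ⟨Finset.Subset.refl _, ?_, fun w hw hn => absurd hw hn⟩
    obtain ⟨x, hx⟩ : (K.erase r).Nonempty := Finset.card_pos.mp (by
      rw [Finset.card_erase_of_mem hr]; omega)
    have hx' := Finset.mem_erase.mp hx
    obtain ⟨z, hz, zr, zx, f⟩ := tj_cover hF hK h1 hr hx'.2 hx'.1.symm
    exact ⟨x, hx, z, Finset.mem_erase.mpr ⟨zr, hz⟩, zx.symm, Or.inl f⟩
  have hex : ∃ n, ∃ A, P A ∧ A.card = n := ⟨_, _, hPW, rfl⟩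
  obtain ⟨A, hPA, hAc⟩ := Nat.find_spec hex
  have hmin : ∀ B, P B → A.card ≤ B.card := fun B hB => by
    rw [hAc]; exact Nat.find_min' hex ⟨B, hB, rfl⟩
  obtain ⟨hAW, ⟨x, hx, y, hy, xy, hxy⟩, hM⟩ := hPA
  have hA2 : 2 ≤ A.card := Finset.one_lt_card.mpr ⟨x, hx, y, hy, xy⟩
  obtain ⟨B, hBA, hB1, hB2, hno⟩ := hdisc A hAW hA2
  have small : ∀ B' : Finset α, B' ⊆ A → B'.card < A.card →
      ((∀ x ∈ B', ∀ y ∈ A, y ∉ B' → ¬ F {r, x, y}) ∨ (∀ x ∈ B', ∀ y ∈ A, y ∉ B' → ¬ G {r, x, y})) →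
      ∀ x ∈ B', ∀ y ∈ B', x ≠ y → ¬ F {r, x, y} ∧ ¬ G {r, x, y} := by
    intro B' hB' hlt hn x hx y hy xy
    by_contra hq
    refine absurd (hmin B' ⟨hB'.trans hAW, ⟨x, hx, y, hy, xy, by tauto⟩, ?_⟩) (by omega)
    intro w hw hwB x hx y hy f g
    by_cases hwA : w ∈ A
    · rcases hn with hn | hn
      · exact hn x hx w hwA hwB f
      · exact hn y hy w hwA hwB g
    · exact hM w hw hwA x (hB' hx) y (hB' hy) f g
  have hc1 : B.card < A.card := by
    have := Finset.card_sdiff_add_card_eq_card hBA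
    have := Finset.card_pos.mpr hB2
    omega
  have hc2 : (A \ B).card < A.card := by
    have := Finset.card_sdiff_add_card_eq_card hBA
    have := Finset.card_pos.mpr hB1
    omega
  simp only [Finset.mem_sdiff, and_imp] at hno
  have s1 := small B hBA hc1 hno
  have s2 := small (A \ B) Finset.sdiff_subset hc2 (by
    simp only [Finset.mem_sdiff, and_imp, not_and, not_not]
    refine hno.imp ?_ ?_
    · intro h x hx hxB y hy hyB f
      rw [tj_s2] at f
      exact h y (hyB hy) x hx hxB f
    · intro h x hx hxB y hy hyB f
      rw [tj_s2] at f
      exact h y (hyB hy) x hx hxB f)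
  simp only [Finset.mem_sdiff, and_imp] at s2
  rcases hno with hno | hno
  · have hnf : ∀ x ∈ A, ∀ y ∈ A, x ≠ y → ¬ F {r, x, y} := by
      intro x hx y hy xy f
      by_cases hxB : x ∈ B <;> by_cases hyB : y ∈ B
      · exact (s1 x hxB y hyB xy).1 f
      · exact hno x hxB y hy hyB f
      · rw [tj_s2] at f; exact hno y hyB x hx hxB f
      · exact (s2 x hx hxB y hy hyB xy).1 f
    exact tj_core hF hG hK h1 g1 h3 hr hAW hM hnf hx hy xy (hxy.resolve_left (hnf x hx y hy xy))
  · have hnf : ∀ x ∈ A, ∀ y ∈ A, x ≠ y → ¬ G {r, x, y} := by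
      intro x hx y hy xy f
      by_cases hxB : x ∈ B <;> by_cases hyB : y ∈ B
      · exact (s1 x hxB y hyB xy).2 f
      · exact hno x hxB y hy hyB f
      · rw [tj_s2] at f; exact hno y hyB x hx hxB f
      · exact (s2 x hx hxB y hy hyB xy).2 f
    exact tj_core hG hF gK g1 h1 (fun a ha b hb c hc n1 n2 n3 g f => h3 a ha b hb c hc n1 n2 n3 f g)
      hr hAW (fun w hw hwA x hx y hy g f => hM w hw hwA y hy x hx f g) hnf hx hy xy
      (hxy.resolve_right (hnf x hx y hy xy))

end TJComb

section TJBasic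

set_option linter.unusedSectionVars false

variable {E V : Type} [Fintype E] [DecidableEq E] [Fintype V] [DecidableEq V]

/-- incidence mod 2 -/
def tjInc (a b : E → V) (v : V) (e : E) : ZMod 2 :=
  (if a e = v then 1 else 0) + (if b e = v then 1 else 0)

/-- degree mod 2 -/
def tjSg (a b : E → V) (J : Finset E) (v : V) : ZMod 2 := ∑ e ∈ J, tjInc a b v e

/-- edge cut of a vertex set -/
def tjCut (a b : E → V) (U : Finset V) : Finset E :=
  Finset.univ.filter (fun e => ¬ (a e ∈ U ↔ b e ∈ U))

theorem tj_mem_cut (a b : E → V) (U : Finset V) (e : E) :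
    e ∈ tjCut a b U ↔ ¬ (a e ∈ U ↔ b e ∈ U) := by simp [tjCut]

theorem tj_cut_compl (a b : E → V) (U : Finset V) : tjCut a b Uᶜ = tjCut a b U := by
  ext e; simp [tj_mem_cut]; tauto

theorem tj_sum_inc (a b : E → V) (U : Finset V) (e : E) :
    ∑ v ∈ U, tjInc a b v e = if e ∈ tjCut a b U then 1 else 0 := by
  simp only [tjInc, Finset.sum_add_distrib, Finset.sum_ite_eq, tj_mem_cut]
  by_cases h1 : a e ∈ U <;> by_cases h2 : b e ∈ U <;> simp [h1, h2]
  decide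

theorem tj_sum_sg (a b : E → V) (J : Finset E) (U : Finset V) :
    ∑ v ∈ U, tjSg a b J v = ((J ∩ tjCut a b U).card : ZMod 2) := by
  unfold tjSg
  rw [Finset.sum_comm]
  simp only [tj_sum_inc]
  rw [Finset.sum_boole, Finset.filter_mem_eq_inter]

theorem tj_sg_card (a b : E → V) (J : Finset E) (v : V) :
    tjSg a b J v = ((J ∩ tjCut a b {v}).card : ZMod 2) := by
  rw [← tj_sum_sg]; simp

theorem tj_sg_ite (a b : E → V) (J : Finset E) (v : V) :
    tjSg a b J v = ∑ e, if e ∈ J then tjInc a b v e else 0 := by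
  simp [tjSg]

theorem tj_sg_symmDiff (a b : E → V) (J Q : Finset E) (v : V) :
    tjSg a b (symmDiff J Q) v = tjSg a b J v + tjSg a b Q v := by
  simp only [tj_sg_ite, ← Finset.sum_add_distrib]
  refine Finset.sum_congr rfl fun e _ => ?_
  by_cases h1 : e ∈ J <;> by_cases h2 : e ∈ Q <;>
    simp [Finset.mem_symmDiff, h1, h2, CharTwo.add_self_eq_zero]

theorem tj_sg_congr (a b : E → V) (J A : Finset E) (v : V)
    (h : ∀ e, (a e = v ∨ b e = v) → (e ∈ J ↔ e ∈ A)) : tjSg a b J v = tjSg a b A v := by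
  simp only [tj_sg_ite]
  refine Finset.sum_congr rfl fun e _ => ?_
  by_cases h1 : a e = v ∨ b e = v
  · simp [h e h1]
  · push Not at h1
    simp [tjInc, h1.1, h1.2]

theorem tj_mem_cut_single (a b : E → V) (v : V) (e : E) (h : e ∈ tjCut a b {v}) :
    a e = v ∨ b e = v := by
  simp [tj_mem_cut] at h; tauto

theorem tj_cut_congr (a b : E → V) (J A : Finset E) (v : V)
    (h : ∀ e, (a e = v ∨ b e = v) → (e ∈ J ↔ e ∈ A)) :
    J ∩ tjCut a b {v} = A ∩ tjCut a b {v} := by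
  ext e
  simp only [Finset.mem_inter]
  constructor
  · rintro ⟨h1, h2⟩; exact ⟨(h e (tj_mem_cut_single _ _ _ _ h2)).mp h1, h2⟩
  · rintro ⟨h1, h2⟩; exact ⟨(h e (tj_mem_cut_single _ _ _ _ h2)).mpr h1, h2⟩

/-- T-joins -/
def tjJoin (a b : E → V) (t : V → ZMod 2) (J : Finset E) : Prop := ∀ v, tjSg a b J v = t v

/-- odd sets -/
def tjOdd (t : V → ZMod 2) (U : Finset V) : Prop := ∑ v ∈ U, t v = 1

theorem tj_nat_odd (n : ℕ) (h : (n : ZMod 2) = 1) : Odd n := by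
  rwa [ZMod.natCast_eq_one_iff_odd] at h

theorem tj_join_odd {a b : E → V} {t : V → ZMod 2} {J : Finset E} {U : Finset V}
    (hJ : ∑ v ∈ U, tjSg a b J v = ∑ v ∈ U, t v) (hU : tjOdd t U) :
    Odd (J ∩ tjCut a b U).card := by
  apply tj_nat_odd
  rw [← tj_sum_sg, hJ]; exact hU

theorem tjJoin.odd {a b : E → V} {t : V → ZMod 2} {J : Finset E} (hJ : tjJoin a b t J)
    {U : Finset V} (hU : tjOdd t U) : Odd (J ∩ tjCut a b U).card :=
  tj_join_odd (Finset.sum_congr rfl fun v _ => hJ v) hU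

theorem tjJoin.pos {a b : E → V} {t : V → ZMod 2} {J : Finset E} (hJ : tjJoin a b t J)
    {U : Finset V} (hU : tjOdd t U) : 1 ≤ (J ∩ tjCut a b U).card :=
  (hJ.odd hU).pos

theorem tj_zmod2 (x : ZMod 2) : x = 0 ∨ x = 1 := by
  revert x; decide

/-- indicator -/
def tjInd (J : Finset E) (e : E) : ℤ := if e ∈ J then 1 else 0

theorem tj_sum_ind (J C : Finset E) : ∑ e ∈ C, tjInd J e = ((J ∩ C).card : ℤ) := by
  simp only [tjInd, Finset.sum_boole, Finset.filter_mem_eq_inter, Finset.inter_comm]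

/-- families of sets with bounded load -/
def tjFam (P : Finset E → Prop) (n : ℤ) (u : E → ℤ) : Prop :=
  ∃ (ι : Type) (_ : Fintype ι) (J : ι → Finset E), (Fintype.card ι : ℤ) = n ∧ (∀ i, P (J i)) ∧
    ∀ e, ∑ i, tjInd (J i) e ≤ u e

/-- dyadic packings -/
def tjDP (P : Finset E → Prop) (w : E → ℤ) (τ : ℤ) : Prop :=
  ∃ k : ℕ, tjFam P (2 ^ k * τ) (fun e => 2 ^ k * w e)

theorem tjFam.add {P : Finset E → Prop} {n m : ℤ} {u v : E → ℤ} (h1 : tjFam P n u)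
    (h2 : tjFam P m v) : tjFam P (n + m) (fun e => u e + v e) := by
  obtain ⟨ι, _, J, a1, a2, a3⟩ := h1
  obtain ⟨κ, _, K, b1, b2, b3⟩ := h2
  refine ⟨ι ⊕ κ, inferInstance, Sum.elim J K, by simp [a1, b1], ?_, ?_⟩
  · rintro (i | i)
    · exact a2 i
    · exact b2 i
  · intro e
    rw [Fintype.sum_sum_type]
    exact add_le_add (a3 e) (b3 e)

theorem tjFam.nsmul {P : Finset E → Prop} {n : ℤ} {u : E → ℤ} (h1 : tjFam P n u) (m : ℕ) :
    tjFam P (m * n) (fun e => m * u e) := by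
  obtain ⟨ι, _, J, a1, a2, a3⟩ := h1
  refine ⟨Fin m × ι, inferInstance, fun p => J p.2, by simp [a1], fun p => a2 _, fun e => ?_⟩
  rw [Fintype.sum_prod_type]
  simp only [Finset.sum_const, Finset.card_univ, Fintype.card_fin, nsmul_eq_mul]
  exact mul_le_mul_of_nonneg_left (a3 e) (by positivity)

theorem tjFam.mono {P : Finset E → Prop} {n : ℤ} {u v : E → ℤ} (h1 : tjFam P n u)
    (h : ∀ e, u e ≤ v e) : tjFam P n v := by
  obtain ⟨ι, _, J, a1, a2, a3⟩ := h1
  exact ⟨ι, _, J, a1, a2, fun e => (a3 e).trans (h e)⟩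

theorem tjFam.conv {P : Finset E → Prop} {n m : ℤ} {u v : E → ℤ} (h1 : tjFam P n u)
    (hn : n = m) (h : ∀ e, u e = v e) : tjFam P m v := by
  subst hn
  exact h1.mono fun e => (h e).le

theorem tjFam.imp {P Q : Finset E → Prop} {n : ℤ} {u : E → ℤ} (h1 : tjFam P n u)
    (h : ∀ J, P J → Q J) : tjFam Q n u := by
  obtain ⟨ι, _, J, a1, a2, a3⟩ := h1
  exact ⟨ι, _, J, a1, fun i => h _ (a2 i), a3⟩

theorem tjFam.single {P : Finset E → Prop} {J : Finset E} (h : P J) : tjFam P 1 (tjInd J) :=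
  ⟨Unit, inferInstance, fun _ => J, by simp, fun _ => h, fun e => by simp⟩

theorem tjFam.sub {P : Finset E → Prop} {n m : ℤ} {u : E → ℤ} (h1 : tjFam P n u) (h0 : 0 ≤ m)
    (h : m ≤ n) : tjFam P m u := by
  classical
  obtain ⟨ι, _, J, a1, a2, a3⟩ := h1
  obtain ⟨s, -, hs⟩ := Finset.exists_subset_card_eq (s := (Finset.univ : Finset ι))
    (n := m.toNat) (by rw [Finset.card_univ]; omega)
  refine ⟨s, inferInstance, fun i => J i, by simp [hs, h0], fun i => a2 _, fun e => ?_⟩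
  refine le_trans ?_ (a3 e)
  rw [Finset.sum_coe_sort s (fun i => tjInd (J i) e)]
  exact Finset.sum_le_sum_of_subset_of_nonneg (Finset.subset_univ _)
    (fun i _ _ => by unfold tjInd; split_ifs <;> simp)

theorem tjFam.up {P : Finset E → Prop} {k : ℕ} {τ : ℤ} {w : E → ℤ}
    (h1 : tjFam P (2 ^ k * τ) (fun e => 2 ^ k * w e)) (l : ℕ) :
    tjFam P (2 ^ (k + l) * τ) (fun e => 2 ^ (k + l) * w e) := by
  have := h1.nsmul (2 ^ l)
  push_cast at this
  exact this.conv (by ring) (fun e => by ring)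

theorem tjDP.add {P : Finset E → Prop} {n m : ℤ} {u v : E → ℤ} (h1 : tjDP P u n)
    (h2 : tjDP P v m) : tjDP P (fun e => u e + v e) (n + m) := by
  obtain ⟨k, h1⟩ := h1
  obtain ⟨l, h2⟩ := h2
  refine ⟨k + l, ?_⟩
  have h2' := h2.up k
  rw [add_comm l k] at h2'
  have := (h1.up l).add h2'
  exact this.conv (by ring) (fun e => by ring)

theorem tjDP.sub {P : Finset E → Prop} {n m : ℤ} {u : E → ℤ} (h1 : tjDP P u n) (h0 : 0 ≤ m)
    (h : m ≤ n) : tjDP P u m := by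
  obtain ⟨k, h1⟩ := h1
  exact ⟨k, h1.sub (by positivity) (mul_le_mul_of_nonneg_left h (by positivity))⟩

theorem tjDP.copies {P : Finset E → Prop} {J : Finset E} (h : P J) (s : ℕ) :
    tjDP P (fun e => s * tjInd J e) s := by
  refine ⟨0, ?_⟩
  have := (tjFam.single h).nsmul s
  simpa using this

theorem tjDP.unscale {P : Finset E → Prop} {k : ℕ} {w u : E → ℤ} {τ n : ℤ}
    (h1 : tjDP P u n) (hu : ∀ e, u e = 2 ^ k * w e) (hn : n = 2 ^ k * τ) : tjDP P w τ := by
  obtain ⟨l, h1⟩ := h1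
  refine ⟨l + k, ?_⟩
  exact h1.conv (by rw [hn]; ring) (fun e => by rw [hu]; ring)

/-- peel off s copies of a join -/
theorem tjDP.peel {P : Finset E → Prop} {J : Finset E} (h : P J) {s : ℤ} (hs : 0 ≤ s) {k : ℕ}
    {w u : E → ℤ} {τ n : ℤ} (h1 : tjDP P u n) (hu : ∀ e, u e + s * tjInd J e = 2 ^ k * w e)
    (hn : n + s = 2 ^ k * τ) : tjDP P w τ := by
  lift s to ℕ using hs
  exact (h1.add (tjDP.copies h s)).unscale hu hn

/-- counting lemma: double count on a cut -/
theorem tj_count {ι : Type} [Fintype ι] {J : ι → Finset E} {C : Finset E} {u : E → ℤ} {n : ℤ}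
    (hn : (Fintype.card ι : ℤ) = n) (hu : ∀ e ∈ C, ∑ i, tjInd (J i) e ≤ u e)
    (hC : ∑ e ∈ C, u e ≤ n) (h1 : ∀ i, 1 ≤ (J i ∩ C).card) :
    (∀ i, (J i ∩ C).card = 1) ∧ ∀ e ∈ C, ∑ i, tjInd (J i) e = u e := by
  have e1 : ∑ i, ((J i ∩ C).card : ℤ) = ∑ e ∈ C, ∑ i, tjInd (J i) e := by
    rw [Finset.sum_comm]
    exact Finset.sum_congr rfl fun i _ => (tj_sum_ind _ _).symm
  have e2 : (∑ i : ι, (1 : ℤ)) ≤ ∑ i, ((J i ∩ C).card : ℤ) :=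
    Finset.sum_le_sum fun i _ => by exact_mod_cast h1 i
  have e3 : (∑ i : ι, (1 : ℤ)) = n := by simp [hn]
  have e4 : ∑ e ∈ C, ∑ i, tjInd (J i) e ≤ ∑ e ∈ C, u e := Finset.sum_le_sum hu
  constructor
  · have := (Finset.sum_eq_sum_iff_of_le (s := Finset.univ) (f := fun _ : ι => (1 : ℤ))
      (g := fun i => ((J i ∩ C).card : ℤ)) (fun i _ => by exact_mod_cast h1 i)).mp (by linarith)
    intro i
    have := this i (Finset.mem_univ _)
    exact_mod_cast this.symm
  · exact (Finset.sum_eq_sum_iff_of_le hu).mp (by linarith)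

/-- support -/
def tjFeas (a b : E → V) (t : V → ZMod 2) (w : E → ℤ) (τ : ℤ) : Prop :=
  (∀ e, 0 ≤ w e) ∧ 0 ≤ τ ∧ ∀ U, tjOdd t U → τ ≤ ∑ e ∈ tjCut a b U, w e

/-- slack -/
def tjSl (a b : E → V) (w : E → ℤ) (τ : ℤ) (U : Finset V) : ℤ := ∑ e ∈ tjCut a b U, w e - τ

/-- slack of a set -/
def tjR (a b : E → V) (J : Finset E) (U : Finset V) : ℤ := ((J ∩ tjCut a b U).card : ℤ) - 1

theorem tj_sl_lin (a b : E → V) (w u : E → ℤ) (τ n c d : ℤ) (J : Finset E)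
    (hu : ∀ e, u e = c * w e + d * tjInd J e) (hn : n = c * τ + d) (U : Finset V) :
    tjSl a b u n U = c * tjSl a b w τ U + d * tjR a b J U := by
  unfold tjSl tjR
  simp only [hu, hn, Finset.sum_add_distrib, ← Finset.mul_sum, tj_sum_ind]
  ring

theorem tj_odd_compl {t : V → ZMod 2} (ht : ∑ v, t v = 0) {U : Finset V} (h : tjOdd t U) :
    tjOdd t Uᶜ := by
  unfold tjOdd at *
  have := Finset.sum_add_sum_compl U t
  rw [ht, h] at this
  rcases tj_zmod2 (∑ v ∈ Uᶜ, t v) with h | h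
  · rw [h] at this; exact absurd this (by decide)
  · exact h

end TJBasic

section TJKey

set_option linter.unusedSectionVars false

variable {E V : Type} [Fintype E] [DecidableEq E] [Fintype V] [DecidableEq V]

/-- glue two edge sets along a cut -/
def tjGlue (a b : E → V) (U : Finset V) (A B : Finset E) : Finset E :=
  Finset.univ.filter (fun e => if a e ∈ U ∨ b e ∈ U then e ∈ A else e ∈ B)

theorem tj_mem_glue (a b : E → V) (U : Finset V) (A B : Finset E) (e : E) :
    e ∈ tjGlue a b U A B ↔ if a e ∈ U ∨ b e ∈ U then e ∈ A else e ∈ B := by simp [tjGlue]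

theorem tj_glue_in {a b : E → V} {U : Finset V} {A B : Finset E} {v : V} (hv : v ∈ U) (e : E)
    (he : a e = v ∨ b e = v) : e ∈ tjGlue a b U A B ↔ e ∈ A := by
  rw [tj_mem_glue, if_pos]
  rcases he with rfl | rfl
  · exact Or.inl hv
  · exact Or.inr hv

theorem tj_glue_cut {a b : E → V} {U : Finset V} {A B : Finset E} {e : E}
    (he : e ∈ tjCut a b U) : e ∈ tjGlue a b U A B ↔ e ∈ A := by
  rw [tj_mem_cut] at he
  rw [tj_mem_glue, if_pos]
  tauto

theorem tj_glue_out {a b : E → V} {U : Finset V} {A B : Finset E}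
    (h : A ∩ tjCut a b U = B ∩ tjCut a b U) {v : V} (hv : v ∉ U) (e : E)
    (he : a e = v ∨ b e = v) : e ∈ tjGlue a b U A B ↔ e ∈ B := by
  by_cases h1 : a e ∈ U ∨ b e ∈ U
  · have hc : e ∈ tjCut a b U := by
      rw [tj_mem_cut]
      rcases he with rfl | rfl <;> tauto
    have := Finset.ext_iff.mp h e
    simp only [Finset.mem_inter, hc, and_true] at this
    rw [tj_glue_cut hc, this]
  · rw [tj_mem_glue, if_neg h1]

theorem tj_glue_inter {a b : E → V} {U : Finset V} {A B : Finset E} :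
    tjGlue a b U A B ∩ tjCut a b U = A ∩ tjCut a b U := by
  ext e
  simp only [Finset.mem_inter]
  constructor
  · rintro ⟨h1, h2⟩; exact ⟨(tj_glue_cut h2).mp h1, h2⟩
  · rintro ⟨h1, h2⟩; exact ⟨(tj_glue_cut h2).mpr h1, h2⟩

theorem tj_orient (a b : E → V) (u : V) (e : E) (h : e ∈ tjCut a b {u}) :
    ∃ v, v ≠ u ∧ (∀ x, tjInc a b x e = (if u = x then 1 else 0) + (if v = x then 1 else 0)) ∧
      (∀ U, e ∈ tjCut a b U ↔ ¬ (u ∈ U ↔ v ∈ U)) ∧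
      (∀ x, (a e = x ∨ b e = x) ↔ (u = x ∨ v = x)) := by
  simp only [tj_mem_cut, Finset.mem_singleton] at h
  by_cases h1 : a e = u
  · refine ⟨b e, by tauto, fun x => by rw [tjInc, h1], fun U => by rw [tj_mem_cut, h1],
      fun x => by rw [h1]⟩
  · refine ⟨a e, h1, fun x => ?_, fun U => ?_, fun x => ?_⟩
    · have : b e = u := by tauto
      rw [tjInc, this, add_comm]
    · have : b e = u := by tauto
      rw [tj_mem_cut, this]; tauto
    · have : b e = u := by tauto
      rw [this, or_comm]

theorem tj_sg_insert (a b : E → V) {Q : Finset E} {e : E} (h : e ∉ Q) (v : V) :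
    tjSg a b (insert e Q) v = tjInc a b v e + tjSg a b Q v := by
  unfold tjSg; rw [Finset.sum_insert h]

theorem tj_sg_erase (a b : E → V) {Q : Finset E} {e : E} (h : e ∈ Q) (v : V) :
    tjSg a b (Q.erase e) v = tjSg a b Q v + tjInc a b v e := by
  have := tj_sg_insert a b (Finset.notMem_erase e Q) v
  rw [Finset.insert_erase h] at this
  rw [this, add_right_comm, CharTwo.add_self_eq_zero, zero_add]

theorem tj_trail (a b : E → V) (U : Finset V) : ∀ (n : ℕ) (D : Finset E) (u : V), D.card ≤ n →
    u ∈ U → tjSg a b D u = 1 → (∀ v ∈ U, v ≠ u → tjSg a b D v = 0) →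
    ∃ Q ⊆ D, (Q ∩ tjCut a b U).card = 1 ∧ ∀ v ∈ U, tjSg a b Q v = tjSg a b D v := by
  intro n
  induction n with
  | zero =>
    intro D u hD hu h1 h2
    have : D = ∅ := Finset.card_eq_zero.mp (by omega)
    subst this
    simp [tjSg] at h1
  | succ n ih =>
    intro D u hD hu h1 h2
    have hne : (D ∩ tjCut a b {u}).Nonempty := by
      rw [Finset.nonempty_iff_ne_empty]
      intro h
      rw [tj_sg_card, h] at h1
      simp at h1
    obtain ⟨e, he⟩ := hne
    rw [Finset.mem_inter] at he
    obtain ⟨v, hvu, hinc, hcut, -⟩ := tj_orient a b u e he.2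
    by_cases hvU : v ∈ U
    · have hs : ∀ x, tjSg a b (D.erase e) x = tjSg a b D x + tjInc a b x e :=
        tj_sg_erase a b he.1
      obtain ⟨Q, hQ, hQ1, hQ2⟩ := ih (D.erase e) v (by
          rw [Finset.card_erase_of_mem he.1]; omega) hvU (by
          rw [hs, h2 v hvU hvu, hinc]; simp [hvu.symm])
        (fun x hx hxv => by
          rw [hs, hinc]
          by_cases hxu : x = u
          · subst hxu; rw [h1]; simp [hvu]; decide
          · rw [h2 x hx hxu]; simp [Ne.symm hxv, Ne.symm hxu])
      have heQ : e ∉ Q := fun h => by simpa using hQ h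
      refine ⟨insert e Q, ?_, ?_, ?_⟩
      · intro x hx
        rw [Finset.mem_insert] at hx
        rcases hx with rfl | hx
        · exact he.1
        · exact Finset.mem_of_mem_erase (hQ hx)
      · rw [Finset.insert_inter_of_notMem]
        · exact hQ1
        · rw [hcut]; tauto
      · intro x hx
        rw [tj_sg_insert a b heQ, hQ2 x hx, hs, add_comm, add_assoc, CharTwo.add_self_eq_zero,
          add_zero]
    · refine ⟨{e}, by simpa using he.1, ?_, ?_⟩
      · rw [Finset.singleton_inter_of_mem]
        · simp
        · rw [hcut]; tauto
      · intro x hx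
        have : tjSg a b {e} x = tjInc a b x e := by simp [tjSg]
        rw [this, hinc]
        have hvx : v ≠ x := by rintro rfl; exact hvU hx
        by_cases hxu : x = u
        · subst hxu; rw [h1]; simp [hvx]
        · rw [h2 x hx hxu]; simp [hvx, Ne.symm hxu]

/-- feasible traces on the cut -/
def tjTr (a b : E → V) (t : V → ZMod 2) (S : Finset E) (Tt : V → Prop) (U : Finset V)
    (X : Finset E) : Prop :=
  ∃ A ⊆ S, (∀ v ∈ U, tjSg a b A v = t v ∧ (Tt v → (A ∩ tjCut a b {v}).card = 1)) ∧
    A ∩ tjCut a b U = X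

theorem tj_exch (a b : E → V) (t : V → ZMod 2) (S : Finset E) (Tt : V → Prop) (U : Finset V) :
    TJExch (tjTr a b t S Tt U) := by
  rintro X Y ⟨A, hAS, hA, rfl⟩ ⟨A', hAS', hA', rfl⟩ x hx
  have hx' : x ∈ tjCut a b U ∧ x ∈ symmDiff A A' := by
    simp only [Finset.mem_symmDiff, Finset.mem_inter] at hx ⊢; tauto
  obtain ⟨hxC, hxD⟩ := hx'
  have h0 : ∀ v ∈ U, tjSg a b (symmDiff A A') v = 0 := fun v hv => by
    rw [tj_sg_symmDiff, (hA v hv).1, (hA' v hv).1, CharTwo.add_self_eq_zero]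
  obtain ⟨u, v, huU, hvU, hvu, hinc⟩ : ∃ u v, u ∈ U ∧ v ∉ U ∧ v ≠ u ∧
      ∀ y, tjInc a b y x = (if u = y then 1 else 0) + (if v = y then 1 else 0) := by
    have hxC' := hxC
    rw [tj_mem_cut] at hxC'
    by_cases h : a x ∈ U
    · have hb : b x ∉ U := by tauto
      exact ⟨a x, b x, h, hb, fun e => hb (e ▸ h), fun y => rfl⟩
    · have hb : b x ∈ U := by tauto
      exact ⟨b x, a x, hb, h, fun e => h (e ▸ hb), fun y => by rw [tjInc, add_comm]⟩
  have hincU : ∀ y ∈ U, tjInc a b y x = if u = y then 1 else 0 := fun y hy => by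
    have : v ≠ y := by rintro rfl; exact hvU hy
    rw [hinc]; simp [this]
  obtain ⟨Q, hQ, hQ1, hQ2⟩ := tj_trail a b U _ ((symmDiff A A').erase x) u le_rfl huU
    (by rw [tj_sg_erase a b hxD, h0 u huU, hincU u huU]; simp)
    (fun y hy hyu => by
      rw [tj_sg_erase a b hxD, h0 y hy, hincU y hy]; simp [Ne.symm hyu])
  have hxQ : x ∉ Q := fun h => by simpa using hQ h
  have hQD : Q ⊆ symmDiff A A' := hQ.trans (Finset.erase_subset _ _)
  obtain ⟨y, hy⟩ := Finset.card_eq_one.mp hQ1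
  have hyQ : ∀ z, z ∈ Q ∧ z ∈ tjCut a b U ↔ z = y := fun z => by
    rw [← Finset.mem_inter, hy, Finset.mem_singleton]
  have hyy := (hyQ y).mpr rfl
  have hyD := hQD hyy.1
  have hsq : ∀ z ∈ U, tjSg a b (insert x Q) z = 0 := fun z hz => by
    rw [tj_sg_insert a b hxQ, hQ2 z hz, tj_sg_erase a b hxD, h0 z hz, zero_add,
      CharTwo.add_self_eq_zero]
  have hsub : ∀ z, z ∈ symmDiff A (insert x Q) → z ∈ A ∨ z ∈ A' := by
    intro z hz
    simp only [Finset.mem_symmDiff, Finset.mem_insert] at hz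
    rcases hz with hz | ⟨rfl | hz, hz'⟩
    · exact Or.inl hz.1
    · simp only [Finset.mem_symmDiff] at hxD; tauto
    · have := hQD hz
      simp only [Finset.mem_symmDiff] at this; tauto
  refine ⟨y, ?_, ?_, symmDiff A (insert x Q), ?_, ?_, ?_⟩
  · have h2 := hyy.2
    simp only [Finset.mem_symmDiff, Finset.mem_inter] at hyD ⊢; tauto
  · rintro rfl; exact hxQ hyy.1
  · intro z hz
    rcases hsub z hz with h | h
    · exact hAS h
    · exact hAS' h
  · intro z hz
    have hs : tjSg a b (symmDiff A (insert x Q)) z = t z := by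
      rw [tj_sg_symmDiff, hsq z hz, add_zero, (hA z hz).1]
    refine ⟨hs, fun hT => ?_⟩
    have c1 := (hA z hz).2 hT
    have c2 := (hA' z hz).2 hT
    have t1 : t z = 1 := by rw [← (hA z hz).1, tj_sg_card, c1]; simp
    rw [t1, tj_sg_card] at hs
    have hodd := tj_nat_odd _ hs
    have hle : (symmDiff A (insert x Q) ∩ tjCut a b {z}).card ≤ 2 := by
      calc _ ≤ ((A ∩ tjCut a b {z}) ∪ (A' ∩ tjCut a b {z})).card := by
            apply Finset.card_le_card
            intro q hq
            rw [Finset.mem_inter] at hq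
            simp only [Finset.mem_union, Finset.mem_inter]
            rcases hsub q hq.1 with h | h
            · exact Or.inl ⟨h, hq.2⟩
            · exact Or.inr ⟨h, hq.2⟩
        _ ≤ _ := Finset.card_union_le _ _
        _ = 2 := by rw [c1, c2]
    obtain ⟨m, hm⟩ := hodd
    omega
  · ext z
    have hz := hyQ z
    simp only [Finset.mem_symmDiff, Finset.mem_inter, Finset.mem_insert, Finset.mem_singleton]
    by_cases hzC : z ∈ tjCut a b U
    · simp only [hzC, and_true] at hz ⊢
      rw [hz]
    · have n1 : z ≠ x := by rintro rfl; exact hzC hxC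
      have n2 : z ≠ y := by rintro rfl; exact hzC hyy.2
      simp [hzC, n1, n2]

/-- tight joins -/
def tjTJ (a b : E → V) (t : V → ZMod 2) (S : Finset E) (Tt : V → Prop) (J : Finset E) : Prop :=
  J ⊆ S ∧ ∀ v, tjSg a b J v = t v ∧ (Tt v → (J ∩ tjCut a b {v}).card = 1)

theorem tj_key {a b : E → V} {t : V → ZMod 2} {S : Finset E} {Tt : V → Prop} {U : Finset V}
    {J : Finset E} (hJ : tjTJ a b t S Tt J) (h2 : 2 ≤ (J ∩ tjCut a b U).card)
    (h1 : ∀ e ∈ J ∩ tjCut a b U, ∃ J', tjTJ a b t S Tt J' ∧ J' ∩ tjCut a b U = {e}) :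
    ∃ J', tjTJ a b t S Tt J' ∧
      ((J' ∩ tjCut a b U).card = 3 ∨ (J' ∩ tjCut a b U).card = 5) := by
  have hF : ∀ U' J', tjTJ a b t S Tt J' → tjCut a b U' = tjCut a b U →
      tjTr a b t S Tt U' (J' ∩ tjCut a b U) := fun U' J' h hc =>
    ⟨J', h.1, fun v _ => h.2 v, by rw [hc]⟩
  obtain ⟨X, hX, hc, ⟨A, hAS, hA, hAX⟩, ⟨B, hBS, hB, hBX⟩⟩ :=
    tj_comb (tj_exch a b t S Tt U) (tj_exch a b t S Tt Uᶜ)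
    (K := J ∩ tjCut a b U) (hF U J hJ rfl) (hF Uᶜ J hJ (tj_cut_compl a b U))
    (fun e he => by
      obtain ⟨J', h, h'⟩ := h1 e he
      rw [← h']; exact hF U J' h rfl)
    (fun e he => by
      obtain ⟨J', h, h'⟩ := h1 e he
      rw [← h']; exact hF Uᶜ J' h (tj_cut_compl a b U)) h2
  rw [tj_cut_compl] at hBX
  have hAB : A ∩ tjCut a b U = B ∩ tjCut a b U := by rw [hAX, hBX]
  refine ⟨tjGlue a b U A B, ⟨?_, fun v => ?_⟩, ?_⟩
  · intro e he
    rw [tj_mem_glue] at he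
    split_ifs at he
    · exact hAS he
    · exact hBS he
  · by_cases hv : v ∈ U
    · rw [tj_sg_congr a b _ _ v (fun e he => tj_glue_in (B := B) hv e he),
        tj_cut_congr a b _ _ v (fun e he => tj_glue_in (B := B) hv e he)]
      exact hA v hv
    · rw [tj_sg_congr a b _ _ v (fun e he => tj_glue_out hAB hv e he),
        tj_cut_congr a b _ _ v (fun e he => tj_glue_out hAB hv e he)]
      exact hB v (by simpa using hv)
  · rw [tj_glue_inter, hAX]; exact hc

end TJKey

section TJContract

set_option linter.unusedSectionVars false

variable {E V : Type} [Fintype E] [DecidableEq E] [Fintype V] [DecidableEq V]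

/-- outer induction hypothesis -/
def tjOut (E : Type) [Fintype E] [DecidableEq E] (n : ℕ) : Prop :=
  ∀ (V' : Type) [Fintype V'] [DecidableEq V'] (a b : E → V') (t : V' → ZMod 2) (w : E → ℤ) (τ : ℤ),
    Fintype.card V' < n → tjFeas a b t w τ → tjDP (tjJoin a b t) w τ

theorem tj_push_sum {V' : Type} [Fintype V'] [DecidableEq V'] (f : V → V') (g : V → ZMod 2)
    (U' : Finset V') :
    ∑ x ∈ U', ∑ v ∈ Finset.univ.filter (fun v => f v = x), g v =
      ∑ v ∈ Finset.univ.filter (fun v => f v ∈ U'), g v := by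
  rw [← Finset.sum_fiberwise_of_maps_to (s := Finset.univ.filter (fun v => f v ∈ U')) (t := U')
    (g := f) (by simp)]
  refine Finset.sum_congr rfl fun x hx => ?_
  rw [Finset.filter_filter]
  refine Finset.sum_congr ?_ fun _ _ => rfl
  ext v
  simp only [Finset.mem_filter, Finset.mem_univ, true_and]
  constructor
  · rintro rfl; exact ⟨hx, rfl⟩
  · exact fun h => h.2

theorem tj_push_cut {V' : Type} [Fintype V'] [DecidableEq V'] (f : V → V') (a b : E → V)
    (U' : Finset V') :
    tjCut (fun e => f (a e)) (fun e => f (b e)) U' =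
      tjCut a b (Finset.univ.filter (fun v => f v ∈ U')) := by
  ext e; simp [tj_mem_cut]

theorem tj_push_sg {V' : Type} [Fintype V'] [DecidableEq V'] (f : V → V') (a b : E → V)
    (J : Finset E) (x : V') :
    tjSg (fun e => f (a e)) (fun e => f (b e)) J x =
      ∑ v ∈ Finset.univ.filter (fun v => f v = x), tjSg a b J v := by
  rw [tj_sg_card, tj_push_cut, ← tj_sum_sg]
  simp

theorem tj_push {n : ℕ} (hOut : tjOut E n) {V' : Type} [Fintype V'] [DecidableEq V'] (f : V → V')
    (hc : Fintype.card V' < n) {a b : E → V} {t : V → ZMod 2} {w : E → ℤ} {τ : ℤ}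
    (h : tjFeas a b t w τ) :
    tjDP (fun J => ∀ x, ∑ v ∈ Finset.univ.filter (fun v => f v = x), tjSg a b J v =
      ∑ v ∈ Finset.univ.filter (fun v => f v = x), t v) w τ := by
  obtain ⟨k, hk⟩ := hOut V' (fun e => f (a e)) (fun e => f (b e))
    (fun x => ∑ v ∈ Finset.univ.filter (fun v => f v = x), t v) w τ hc
    ⟨h.1, h.2.1, fun U' hU' => by
      rw [tj_push_cut]
      apply h.2.2
      unfold tjOdd at hU' ⊢
      rw [← hU', tj_push_sum]⟩
  refine ⟨k, hk.imp fun J hJ x => ?_⟩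
  have := hJ x
  rwa [tj_push_sg] at this

theorem tj_contract (hOut : tjOut E (Fintype.card V)) {a b : E → V} {t : V → ZMod 2} {w : E → ℤ}
    {τ : ℤ} (h : tjFeas a b t w τ) (U : Finset V) (hU : 2 ≤ U.card) :
    tjDP (fun J => (∀ v, v ∉ U → tjSg a b J v = t v) ∧
      ∑ v ∈ U, tjSg a b J v = ∑ v ∈ U, t v) w τ := by
  classical
  have hcard : Fintype.card (Option {v // v ∉ U}) < Fintype.card V := by
    rw [Fintype.card_option, Fintype.card_subtype_compl, Fintype.card_coe]
    have := Finset.card_le_univ U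
    omega
  obtain ⟨k, hk⟩ := tj_push hOut (V' := Option {v // v ∉ U})
    (fun v => if h : v ∉ U then some ⟨v, h⟩ else none) hcard h
  refine ⟨k, hk.imp fun J hJ => ⟨fun v hv => ?_, ?_⟩⟩
  · have := hJ (some ⟨v, hv⟩)
    have e : (Finset.univ.filter (fun u => (if h : u ∉ U then some (⟨u, h⟩ : {v // v ∉ U}) else none)
        = some ⟨v, hv⟩)) = {v} := by
      ext u
      simp only [Finset.mem_filter, Finset.mem_univ, true_and, Finset.mem_singleton]
      split_ifs with hu
      · simp only [false_iff]
        rintro rfl; exact hv hu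
      · simp
    rw [e] at this
    simpa using this
  · have := hJ none
    have e : (Finset.univ.filter (fun u => (if h : u ∉ U then some (⟨u, h⟩ : {v // v ∉ U}) else none)
        = none)) = U := by
      ext u
      simp only [Finset.mem_filter, Finset.mem_univ, true_and]
      split_ifs with hu
      · simp [hu]
      · simpa using hu
    rwa [e] at this

theorem tj_fibers {ι κ : Type} [Fintype ι] [Fintype κ] (φ : ι → E) (ψ : κ → E)
    (h : ∀ e, ∑ i, tjInd {φ i} e = ∑ i, tjInd {ψ i} e) : ∃ σ : ι ≃ κ, ∀ i, ψ (σ i) = φ i := by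
  classical
  have hc : ∀ e, Fintype.card {i // φ i = e} = Fintype.card {i // ψ i = e} := by
    intro e
    have := h e
    simp only [tjInd, Finset.mem_singleton, Finset.sum_boole] at this
    rw [Fintype.card_subtype, Fintype.card_subtype]
    have h2 : ∀ (ρ : Type) [Fintype ρ] (g : ρ → E), (Finset.univ.filter (fun i => g i = e)) =
        Finset.univ.filter (fun i => e = g i) := by
      intro ρ _ g; ext i; simp [eq_comm]
    rw [h2, h2]
    exact_mod_cast this
  exact ⟨Equiv.ofFiberEquiv (fun e => Fintype.equivOfCardEq (hc e)),
    fun i => Equiv.ofFiberEquiv_map _ i⟩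

theorem tj_step0 (hOut : tjOut E (Fintype.card V)) {a b : E → V} {t : V → ZMod 2} {w : E → ℤ}
    {τ : ℤ} (h : tjFeas a b t w τ) (U : Finset V) (hU : 2 ≤ U.card) (hU' : 2 ≤ Uᶜ.card)
    (hodd : tjOdd t U) (htight : tjSl a b w τ U = 0) : tjDP (tjJoin a b t) w τ := by
  classical
  obtain ⟨k, hk⟩ := tj_contract hOut h Uᶜ hU'
  obtain ⟨l, hl⟩ := tj_contract hOut h U hU
  replace hk := hk.up l
  replace hl := hl.up k
  rw [add_comm l k] at hl
  set m := k + l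
  obtain ⟨ι, _, A, a1, a2, a3⟩ := hk
  obtain ⟨κ, _, B, b1, b2, b3⟩ := hl
  have hC : ∑ e ∈ tjCut a b U, 2 ^ m * w e ≤ 2 ^ m * τ := by
    rw [← Finset.mul_sum]
    unfold tjSl at htight
    rw [sub_eq_zero.mp htight]
  have hA : ∀ i, ∀ v ∈ U, tjSg a b (A i) v = t v := fun i v hv => (a2 i).1 v (by simpa using hv)
  obtain ⟨ca, ca'⟩ := tj_count (C := tjCut a b U) a1 (fun e _ => a3 e) hC
    (fun i => (tj_join_odd (Finset.sum_congr rfl (hA i)) hodd).pos)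
  obtain ⟨cb, cb'⟩ := tj_count (C := tjCut a b U) b1 (fun e _ => b3 e) hC
    (fun i => (tj_join_odd (b2 i).2 hodd).pos)
  choose φ hφ using fun i => Finset.card_eq_one.mp (ca i)
  choose ψ hψ using fun i => Finset.card_eq_one.mp (cb i)
  have hind : ∀ (A : Finset E) (f : E), A ∩ tjCut a b U = {f} → ∀ e,
      tjInd {f} e = if e ∈ tjCut a b U then tjInd A e else 0 := by
    intro A f hf e
    rw [← hf]
    by_cases hA : e ∈ A <;> by_cases hC : e ∈ tjCut a b U <;> simp [tjInd, hA, hC]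
  obtain ⟨σ, hσ⟩ := tj_fibers φ ψ (by
    intro e
    simp only [hind _ _ (hφ _), hind _ _ (hψ _)]
    split_ifs with he
    · rw [ca' e he, cb' e he]
    · simp)
  have hAB : ∀ i, A i ∩ tjCut a b U = B (σ i) ∩ tjCut a b U := fun i => by
    rw [hφ, hψ, hσ]
  refine ⟨m, ι, inferInstance, fun i => tjGlue a b U (A i) (B (σ i)), a1, fun i v => ?_, fun e => ?_⟩
  · by_cases hv : v ∈ U
    · rw [tj_sg_congr a b _ _ v (fun e he => tj_glue_in (B := B (σ i)) hv e he)]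
      exact hA i v hv
    · rw [tj_sg_congr a b _ _ v (fun e he => tj_glue_out (hAB i) hv e he)]
      exact (b2 (σ i)).1 v hv
  · by_cases he : a e ∈ U ∨ b e ∈ U
    · refine le_trans (le_of_eq ?_) (a3 e)
      refine Finset.sum_congr rfl fun i _ => ?_
      simp [tjInd, tj_mem_glue, he]
    · refine le_trans (le_of_eq ?_) (b3 e)
      rw [← Equiv.sum_comp σ]
      refine Finset.sum_congr rfl fun i _ => ?_
      simp [tjInd, tj_mem_glue, he]

end TJContract

section TJTight

set_option linter.unusedSectionVars false

variable {E V : Type} [Fintype E] [DecidableEq E] [Fintype V] [DecidableEq V]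

/-- tight vertex -/
def tjTv (a b : E → V) (t : V → ZMod 2) (w : E → ℤ) (τ : ℤ) (v : V) : Prop :=
  tjOdd t {v} ∧ tjSl a b w τ {v} = 0

/-- support of a weight -/
def tjSupp (w : E → ℤ) : Finset E := Finset.univ.filter (fun e => w e ≠ 0)

theorem tj_ind_nonneg (J : Finset E) (e : E) : 0 ≤ tjInd J e := by
  unfold tjInd; split_ifs <;> simp

theorem tj_supp_of_count {ι : Type} [Fintype ι] {J : ι → Finset E} {w : E → ℤ} {k : ℕ}
    (h : ∀ e, ∑ i, tjInd (J i) e ≤ 2 ^ k * w e) (i : ι) : J i ⊆ tjSupp w := by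
  intro e he
  simp only [tjSupp, Finset.mem_filter, Finset.mem_univ, true_and]
  intro h0
  have h1 := Finset.single_le_sum (f := fun i => tjInd (J i) e) (fun i _ => tj_ind_nonneg _ _)
    (Finset.mem_univ i)
  have h2 := h e
  rw [h0] at h2
  simp only [tjInd, he, if_true] at h1
  simp only [tjInd] at h2
  linarith

theorem tj_erase_count {ι : Type} [Fintype ι] {J : ι → Finset E} {w : E → ℤ} {k : ℕ} {τ : ℤ}
    {C : Finset E} {e0 : E} (he : e0 ∈ C) (hC : ∑ e ∈ C, w e = τ)
    (h : ∀ e, ∑ i, tjInd (J i) e ≤ 2 ^ k * w e) :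
    ∑ i, ((((J i).erase e0) ∩ C).card : ℤ) ≤ 2 ^ k * (τ - w e0) := by
  have h1 : ∀ i, ((((J i).erase e0) ∩ C).card : ℤ) = ∑ e ∈ C.erase e0, tjInd (J i) e := by
    intro i
    rw [tj_sum_ind]
    congr 2
    ext e; simp; tauto
  simp only [h1]
  rw [Finset.sum_comm, ← hC, ← Finset.sum_erase_add _ _ he, add_sub_cancel_right, Finset.mul_sum]
  exact Finset.sum_le_sum fun e _ => h e

theorem tj_step2 (hOut : tjOut E (Fintype.card V)) {a b : E → V} {t : V → ZMod 2} {w : E → ℤ}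
    {τ : ℤ} (h : tjFeas a b t w τ) (hτ : 0 < τ) {x : V} (hx : tjTv a b t w τ x) :
    ∃ J, tjTJ a b t (tjSupp w) (tjTv a b t w τ) J := by
  classical
  have tight : ∀ v, tjTv a b t w τ v → ∑ e ∈ tjCut a b {v}, w e = τ := fun v hv =>
    sub_eq_zero.mp hv.2
  obtain ⟨e0, he0, hw0⟩ : ∃ e ∈ tjCut a b {x}, 0 < w e := by
    by_contra hcon
    push Not at hcon
    have := Finset.sum_nonpos hcon
    rw [tight x hx] at this
    omega
  obtain ⟨y, hyx, hinc, hcut, hends⟩ := tj_orient a b x e0 he0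
  obtain ⟨k, ι, _, J, j1, j2, j3⟩ := tj_contract hOut h {x, y}
    (by rw [Finset.card_pair hyx.symm])
  have hpow : (0 : ℤ) < 2 ^ k := by positivity
  have hey : e0 ∈ tjCut a b {y} := by rw [hcut]; simp [hyx.symm]
  have htx : t x = 1 := by simpa [tjOdd] using hx.1
  have hsgp : ∀ i, tjSg a b ((J i).erase e0) x + tjSg a b ((J i).erase e0) y = t x + t y := by
    intro i
    have h2 := (j2 i).2
    rw [Finset.sum_pair hyx.symm, Finset.sum_pair hyx.symm] at h2
    by_cases hi : e0 ∈ J i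
    · rw [tj_sg_erase a b hi, tj_sg_erase a b hi, hinc, hinc, ← h2]
      simp only [if_true, hyx, hyx.symm, if_false, add_zero, zero_add]
      rw [add_add_add_comm, CharTwo.add_self_eq_zero (1 : ZMod 2), add_zero]
    · rw [Finset.erase_eq_of_notMem hi, h2]
  have sx := tj_erase_count he0 (tight x hx) j3
  have hlt : 2 ^ k * (τ - w e0) < 2 ^ k * τ := mul_lt_mul_of_pos_left (by omega) hpow
  -- choose the index
  obtain ⟨i, hi1, hi2⟩ : ∃ i, ((J i).erase e0 ∩ tjCut a b {x}).card = 0 ∧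
      (tjTv a b t w τ y → ((J i).erase e0 ∩ tjCut a b {y}).card = 0) := by
    by_contra hcon
    push Not at hcon
    by_cases hy : tjTv a b t w τ y
    · have sy := tj_erase_count hey (tight y hy) j3
      have hty : t y = 1 := by simpa [tjOdd] using hy.1
      have h2 : ∀ i, (2 : ℤ) ≤ ((J i).erase e0 ∩ tjCut a b {x}).card +
          ((J i).erase e0 ∩ tjCut a b {y}).card := by
        intro i
        have p := hsgp i
        rw [tj_sg_card, tj_sg_card, htx, hty, ← Nat.cast_add,
          CharTwo.add_self_eq_zero, ZMod.natCast_eq_zero_iff_even] at p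
        obtain ⟨m, hm⟩ := p
        have := hcon i
        by_cases h0 : ((J i).erase e0 ∩ tjCut a b {x}).card = 0
        · have := (this h0).2
          omega
        · omega
      have h3 : (∑ i : ι, (2 : ℤ)) ≤ _ := Finset.sum_le_sum fun i _ => h2 i
      rw [Finset.sum_add_distrib] at h3
      simp only [Finset.sum_const, Finset.card_univ, nsmul_eq_mul, j1] at h3
      linarith
    · have h2 : ∀ i, (1 : ℤ) ≤ ((J i).erase e0 ∩ tjCut a b {x}).card := by
        intro i
        by_contra h0
        exact hy (hcon i (by omega)).1
      have h3 : (∑ i : ι, (1 : ℤ)) ≤ _ := Finset.sum_le_sum fun i _ => h2 i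
      simp only [Finset.sum_const, Finset.card_univ, nsmul_eq_mul, j1] at h3
      linarith
  have hn : e0 ∉ (J i).erase e0 := Finset.notMem_erase _ _
  have hins : ∀ v, e0 ∈ tjCut a b {v} → ((J i).erase e0 ∩ tjCut a b {v}).card = 0 →
      (insert e0 ((J i).erase e0) ∩ tjCut a b {v}).card = 1 := by
    intro v hv h0
    rw [Finset.insert_inter_of_mem hv, Finset.card_eq_zero.mp h0]; simp
  have hsx : tjSg a b ((J i).erase e0) x = 0 := by rw [tj_sg_card, hi1]; simp
  refine ⟨insert e0 ((J i).erase e0), ?_, fun v => ?_⟩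
  · intro e he
    rw [Finset.mem_insert] at he
    rcases he with rfl | he
    · simp [tjSupp, hw0.ne']
    · exact tj_supp_of_count j3 i (Finset.mem_of_mem_erase he)
  · by_cases hvx : v = x
    · subst hvx
      refine ⟨?_, fun _ => hins _ he0 hi1⟩
      rw [tj_sg_insert a b hn, hinc, hsx, htx]; simp [hyx]
    by_cases hvy : v = y
    · subst hvy
      refine ⟨?_, fun hv => hins _ hey (hi2 hv)⟩
      have := hsgp i
      rw [hsx, zero_add, htx] at this
      rw [tj_sg_insert a b hn, hinc, this]
      simp only [hyx.symm, if_false, if_true, zero_add]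
      rw [← add_assoc, CharTwo.add_self_eq_zero, zero_add]
    · have hcg : ∀ e, (a e = v ∨ b e = v) → (e ∈ insert e0 ((J i).erase e0) ↔ e ∈ J i) := by
        intro e he
        have hne : e ≠ e0 := by
          rintro rfl
          rw [hends] at he
          rcases he with he | he
          · exact hvx he.symm
          · exact hvy he.symm
        simp [hne]
      have hv : v ∉ ({x, y} : Finset V) := by simp [hvx, hvy]
      rw [tj_sg_congr a b _ _ v hcg, tj_cut_congr a b _ _ v hcg]
      refine ⟨(j2 i).1 v hv, fun hT => ?_⟩
      refine (tj_count (C := tjCut a b {v}) j1 (fun e _ => j3 e) ?_ ?_).1 i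
      · rw [← Finset.mul_sum, tight v hT]
      · intro i
        refine (tj_join_odd (t := t) (U := {v}) ?_ hT.1).pos
        simpa using (j2 i).1 v hv

end TJTight

section TJClaim

set_option linter.unusedSectionVars false

variable {E V : Type} [Fintype E] [DecidableEq E] [Fintype V] [DecidableEq V]

theorem tj_minratio {β : Type} (F : Finset β) (hF : F.Nonempty) (s r : β → ℤ)
    (hr : ∀ X ∈ F, 0 < r X) : ∃ X0 ∈ F, ∀ X ∈ F, s X0 * r X ≤ s X * r X0 := by
  obtain ⟨X0, h0, hm⟩ := Finset.exists_min_image F (fun X => (s X : ℚ) / (r X : ℚ)) hF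
  refine ⟨X0, h0, fun X hX => ?_⟩
  have := hm X hX
  have p1 : (0 : ℚ) < r X0 := by exact_mod_cast hr X0 h0
  have p2 : (0 : ℚ) < r X := by exact_mod_cast hr X hX
  rw [div_le_div_iff₀ p1 p2] at this
  exact_mod_cast this

/-- weights with given support and tight sets -/
def tjCls (a b : E → V) (t : V → ZMod 2) (S : Finset E) (𝒯 : Finset V → Prop) (w : E → ℤ) (τ : ℤ) :
    Prop :=
  tjFeas a b t w τ ∧ (∀ e, w e ≠ 0 ↔ e ∈ S) ∧ ∀ U, tjOdd t U → (tjSl a b w τ U = 0 ↔ 𝒯 U)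

/-- inner induction hypothesis -/
def tjHI (a b : E → V) (t : V → ZMod 2) (S : Finset E) (𝒯 : Finset V → Prop) : Prop :=
  ∀ (w : E → ℤ) (τ : ℤ), tjFeas a b t w τ → (∀ e, e ∉ S → w e = 0) →
    (∀ U, tjOdd t U → 𝒯 U → tjSl a b w τ U = 0) →
    ((∃ e ∈ S, w e = 0) ∨ ∃ U, tjOdd t U ∧ ¬ 𝒯 U ∧ tjSl a b w τ U = 0) →
    tjDP (tjJoin a b t) w τ

theorem tj_feas_of {a b : E → V} {t : V → ZMod 2} {w : E → ℤ} {τ : ℤ} {U0 : Finset V}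
    (h1 : ∀ e, 0 ≤ w e) (h2 : ∀ U, tjOdd t U → 0 ≤ tjSl a b w τ U) (h3 : tjSl a b w τ U0 = 0) :
    tjFeas a b t w τ := by
  refine ⟨h1, ?_, fun U hU => ?_⟩
  · have := Finset.sum_nonneg (s := tjCut a b U0) fun e _ => h1 e
    unfold tjSl at h3; omega
  · have := h2 U hU
    unfold tjSl at this; omega

theorem tjFeas.sl {a b : E → V} {t : V → ZMod 2} {w : E → ℤ} {τ : ℤ} (h : tjFeas a b t w τ)
    {U : Finset V} (hU : tjOdd t U) : 0 ≤ tjSl a b w τ U := by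
  have := h.2.2 U hU
  unfold tjSl; omega

theorem tjTJ.join {a b : E → V} {t : V → ZMod 2} {S : Finset E} {Tt : V → Prop} {J : Finset E}
    (h : tjTJ a b t S Tt J) : tjJoin a b t J := fun v => (h.2 v).1

theorem tjTJ.r_nonneg {a b : E → V} {t : V → ZMod 2} {S : Finset E} {Tt : V → Prop} {J : Finset E}
    (h : tjTJ a b t S Tt J) {U : Finset V} (hU : tjOdd t U) : 0 ≤ tjR a b J U := by
  have := h.join.pos hU
  unfold tjR; omega

theorem tj_r_le (a b : E → V) (J : Finset E) (U : Finset V) :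
    tjR a b J U ≤ Fintype.card E := by
  have := Finset.card_le_univ (J ∩ tjCut a b U)
  unfold tjR; omega

theorem tj_claim {a b : E → V} {t : V → ZMod 2} {S : Finset E} {𝒯 : Finset V → Prop}
    {Tt : V → Prop} (hTt : ∀ v, Tt v → tjOdd t {v} ∧ 𝒯 {v})
    (hHI : tjHI a b t S 𝒯) {U0 : Finset V} (hU0 : tjOdd t U0) (hU0' : 𝒯 U0)
    (hTr : ∀ J, tjTJ a b t S Tt J → ∀ U, tjOdd t U → 𝒯 U → tjR a b J U = 0) :
    ∀ (n : ℕ) (w : E → ℤ) (τ : ℤ) (J : Finset E) (p q : ℤ) (D : Finset (Finset V)),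
      D.card ≤ n → tjCls a b t S 𝒯 w τ → tjTJ a b t S Tt J → 0 ≤ p → 0 < q →
      (∀ e ∈ S, 0 < q * w e - p * tjInd J e) →
      (∀ U, tjOdd t U → 0 ≤ q * tjSl a b w τ U - p * tjR a b J U) →
      (∀ U, tjOdd t U → ¬ 𝒯 U → q * tjSl a b w τ U = p * tjR a b J U → U ∈ D) →
      (∃ U, tjOdd t U ∧ ¬ 𝒯 U ∧ q * tjSl a b w τ U = p * tjR a b J U) →
      tjDP (tjJoin a b t) w τ := by
  classical
  intro n
  induction n with
  | zero =>
    rintro w τ J p q D hD - - - - - - hmem ⟨U, h1, h2, h3⟩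
    have := hmem U h1 h2 h3
    rw [Finset.card_eq_zero.mp (by omega : D.card = 0)] at this
    simp at this
  | succ n ih =>
    rintro w τ J p q D hD hcls hJ hp hq hpos hsl hmem ⟨U, hU1, hU2, hU3⟩
    obtain ⟨hfe, hS, h𝒯⟩ := hcls
    have hind0 : ∀ J', tjTJ a b t S Tt J' → ∀ e, e ∉ S → tjInd J' e = 0 := by
      intro J' hJ' e he
      have : e ∉ J' := fun h => he (hJ'.1 h)
      simp [tjInd, this]
    have hw0 : ∀ e, e ∉ S → w e = 0 := fun e he => by
      by_contra h; exact he ((hS e).mp h)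
    have hslU : 0 < tjSl a b w τ U := by
      have h1 := hfe.sl hU1
      have h2 : tjSl a b w τ U ≠ 0 := fun h => hU2 ((h𝒯 U hU1).mp h)
      omega
    have hrU : 0 < tjR a b J U := by
      have h1 := hJ.r_nonneg hU1
      have h2 : tjR a b J U ≠ 0 := by
        intro h
        rw [h, mul_zero] at hU3
        have := mul_pos hq hslU
        omega
      omega
    -- the starred weight
    have sls : ∀ X, tjSl a b (fun e => q * w e - p * tjInd J e) (q * τ - p) X =
        q * tjSl a b w τ X - p * tjR a b J X := fun X => by
      rw [tj_sl_lin a b w _ τ _ q (-p) J (fun e => by ring) (by ring)]; ring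
    have hstar0 : ∀ e, e ∉ S → q * w e - p * tjInd J e = 0 := fun e he => by
      rw [hw0 e he, hind0 J hJ e he]; ring
    have hstarT : ∀ X, tjOdd t X → 𝒯 X → q * tjSl a b w τ X - p * tjR a b J X = 0 :=
      fun X hX hT => by
        rw [(h𝒯 X hX).mpr hT, hTr J hJ X hX hT]; ring
    obtain ⟨k, ι, _, A, a1, a2, a3⟩ := hHI (fun e => q * w e - p * tjInd J e) (q * τ - p)
      (tj_feas_of (U0 := U0) (fun e => by
          by_cases he : e ∈ S
          · exact (hpos e he).le
          · exact (hstar0 e he).ge)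
        (fun X hX => by rw [sls]; exact hsl X hX) (by rw [sls]; exact hstarT U0 hU0 hU0'))
      hstar0 (fun X hX hT => by rw [sls]; exact hstarT X hX hT)
      (Or.inr ⟨U, hU1, hU2, by rw [sls, hU3]; ring⟩)
    have hpow : (0 : ℤ) < 2 ^ k := by positivity
    have cnt : ∀ X, tjOdd t X →
        tjSl a b (fun e => q * w e - p * tjInd J e) (q * τ - p) X = 0 →
        (∀ i, (A i ∩ tjCut a b X).card = 1) ∧
        ∀ e ∈ tjCut a b X, ∑ i, tjInd (A i) e = 2 ^ k * (q * w e - p * tjInd J e) := by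
      intro X hX h0
      refine tj_count a1 (fun e _ => a3 e) ?_ (fun i => (a2 i).pos hX)
      rw [← Finset.mul_sum]
      unfold tjSl at h0
      rw [sub_eq_zero.mp h0]
    have hATJ : ∀ i, tjTJ a b t S Tt (A i) := by
      intro i
      refine ⟨?_, fun v => ⟨a2 i v, fun hv => ?_⟩⟩
      · intro e he
        by_contra hne
        have := tj_supp_of_count a3 i he
        simp only [tjSupp, Finset.mem_filter, Finset.mem_univ, true_and] at this
        exact this (hstar0 e hne)
      · obtain ⟨v1, v2⟩ := hTt v hv
        exact (cnt {v} v1 (by rw [sls]; exact hstarT _ v1 v2)).1 i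
    obtain ⟨J', hJ', hc'⟩ := tj_key (U := U) hJ (by unfold tjR at hrU; omega) (by
      intro e he
      rw [Finset.mem_inter] at he
      obtain ⟨c1, c2⟩ := cnt U hU1 (by rw [sls, hU3]; ring)
      have h1 : 0 < ∑ i, tjInd (A i) e := by
        rw [c2 e he.2]
        exact mul_pos hpow (hpos e (hJ.1 he.1))
      obtain ⟨i, -, hi⟩ := Finset.exists_ne_zero_of_sum_ne_zero h1.ne'
      have hei : e ∈ A i := by
        by_contra hne; simp [tjInd, hne] at hi
      refine ⟨A i, hATJ i, ?_⟩
      obtain ⟨f, hf⟩ := Finset.card_eq_one.mp (c1 i)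
      have : e ∈ A i ∩ tjCut a b U := Finset.mem_inter.mpr ⟨hei, he.2⟩
      rw [hf, Finset.mem_singleton] at this
      rw [hf, this])
    -- scaling
    obtain ⟨N, hN⟩ : ∃ N : ℤ, N = Fintype.card E := ⟨_, rfl⟩
    have hN0 : 0 ≤ N := by omega
    have hrN : ∀ J X, tjR a b J X ≤ N := fun J X => by rw [hN]; exact tj_r_le a b J X
    obtain ⟨M, hM⟩ : ∃ M : ℤ, M = 2 * N ^ 2 + 2 * N + 1 := ⟨_, rfl⟩
    obtain ⟨K, hK⟩ : ∃ K : ℕ, q * M ≤ 2 ^ K := by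
      obtain ⟨K, hK⟩ := pow_unbounded_of_one_lt (q * M).toNat (by norm_num : 1 < 2)
      refine ⟨K, ?_⟩
      have h1 := Int.self_le_toNat (q * M)
      have h2 : ((q * M).toNat : ℤ) < 2 ^ K := by exact_mod_cast hK
      omega
    have hK0 : (0 : ℤ) < 2 ^ K := by positivity
    obtain ⟨j, hj⟩ : ∃ j : ℤ, j = 2 ^ K * p / q := ⟨_, rfl⟩
    obtain ⟨r, hr⟩ : ∃ r : ℤ, r = 2 ^ K * p % q := ⟨_, rfl⟩
    have hjr : q * j + r = 2 ^ K * p := by rw [hj, hr]; exact Int.mul_ediv_add_emod _ _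
    have hr0 : 0 ≤ r := by rw [hr]; exact Int.emod_nonneg _ hq.ne'
    have hrq : r < q := by rw [hr]; exact Int.emod_lt_of_pos _ hq
    have hj0 : 0 ≤ j := by rw [hj]; exact Int.ediv_nonneg (by positivity) hq.le
    obtain ⟨w1, hw1⟩ : ∃ w1 : E → ℤ, ∀ e, w1 e = 2 ^ K * w e - j * tjInd J e := ⟨_, fun _ => rfl⟩
    obtain ⟨τ1, hτ1⟩ : ∃ τ1 : ℤ, τ1 = 2 ^ K * τ - j := ⟨_, rfl⟩
    have sl1 : ∀ X, tjSl a b w1 τ1 X = 2 ^ K * tjSl a b w τ X - j * tjR a b J X := fun X => by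
      rw [tj_sl_lin a b w w1 τ τ1 (2 ^ K) (-j) J (fun e => by rw [hw1]; ring)
        (by rw [hτ1]; ring)]; ring
    have qw1 : ∀ e, q * w1 e = 2 ^ K * (q * w e - p * tjInd J e) + r * tjInd J e := fun e => by
      rw [hw1]; linear_combination (-tjInd J e) * hjr
    have qsl1 : ∀ X, q * tjSl a b w1 τ1 X =
        2 ^ K * (q * tjSl a b w τ X - p * tjR a b J X) + r * tjR a b J X := fun X => by
      rw [sl1]; linear_combination (-tjR a b J X) * hjr
    -- it suffices to pack w1
    suffices hsuff : tjDP (tjJoin a b t) w1 τ1 from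
      hsuff.peel hJ.join hj0 (k := K) (fun e => by rw [hw1]; ring) (by rw [hτ1]; ring)
    have w1M : ∀ e ∈ S, M ≤ w1 e := by
      intro e he
      have h1 := hpos e he
      have h2 : (2 : ℤ) ^ K * 1 ≤ 2 ^ K * (q * w e - p * tjInd J e) :=
        mul_le_mul_of_nonneg_left (by omega) hK0.le
      have h3 := mul_nonneg hr0 (tj_ind_nonneg J e)
      have h4 := qw1 e
      have h5 : q * M ≤ q * w1 e := by linarith
      exact le_of_mul_le_mul_left h5 hq
    have hM0 : 0 < M := by rw [hM]; positivity
    have w10 : ∀ e, e ∉ S → w1 e = 0 := fun e he => by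
      rw [hw1, hw0 e he, hind0 J hJ e he]; ring
    have w1nn : ∀ e, 0 ≤ w1 e := fun e => by
      by_cases he : e ∈ S
      · have := w1M e he; omega
      · exact (w10 e he).ge
    have sl1nn : ∀ X, tjOdd t X → 0 ≤ tjSl a b w1 τ1 X := by
      intro X hX
      have h1 := mul_nonneg hK0.le (hsl X hX)
      have h2 := mul_nonneg hr0 (hJ.r_nonneg hX)
      have h3 : 0 ≤ q * tjSl a b w1 τ1 X := by rw [qsl1]; linarith
      exact nonneg_of_mul_nonneg_right h3 hq
    have sl1T : ∀ X, tjOdd t X → 𝒯 X → tjSl a b w1 τ1 X = 0 := by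
      intro X hX hT
      rw [sl1, (h𝒯 X hX).mpr hT, hTr J hJ X hX hT]; ring
    have hfe1 : tjFeas a b t w1 τ1 := tj_feas_of w1nn sl1nn (sl1T U0 hU0 hU0')
    by_cases hnew : ∃ X, tjOdd t X ∧ ¬ 𝒯 X ∧ tjSl a b w1 τ1 X = 0
    · exact hHI w1 τ1 hfe1 w10 sl1T (Or.inr hnew)
    push Not at hnew
    have hcls1 : tjCls a b t S 𝒯 w1 τ1 := by
      refine ⟨hfe1, fun e => ⟨fun h => ?_, fun h => ?_⟩, fun X hX => ⟨fun h => ?_, sl1T X hX⟩⟩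
      · by_contra he; exact h (w10 e he)
      · have := w1M e h; omega
      · by_contra hT; exact hnew X hX hT h
    have sl1U : tjSl a b w1 τ1 U ≤ N := by
      have h1 : q * tjSl a b w1 τ1 U = r * tjR a b J U := by
        rw [qsl1, hU3]; ring
      have h2 : r * tjR a b J U ≤ q * tjR a b J U := mul_le_mul_of_nonneg_right hrq.le hrU.le
      have h3 : tjSl a b w1 τ1 U ≤ tjR a b J U := le_of_mul_le_mul_left (by linarith) hq
      exact h3.trans (hrN J U)
    have sl1U0 := sl1nn U hU1
    obtain ⟨s, c, hcr, hc0, hsc, hs0, hsN⟩ : ∃ s c : ℤ, tjR a b J' U = c ∧ 0 < c ∧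
        s * c = 4 * tjSl a b w1 τ1 U ∧ 0 ≤ s ∧ s ≤ 2 * N := by
      rcases hc' with hc' | hc'
      · exact ⟨2 * tjSl a b w1 τ1 U, 2, by unfold tjR; rw [hc']; norm_num, by norm_num, by ring,
          by linarith, by linarith⟩
      · exact ⟨tjSl a b w1 τ1 U, 4, by unfold tjR; rw [hc']; norm_num, by norm_num, by ring,
          by linarith, by linarith⟩
    have hMs : s < M := by rw [hM]; nlinarith
    have sl2 : ∀ X, tjSl a b (fun e => 4 * w1 e - s * tjInd J' e) (4 * τ1 - s) X =
        4 * tjSl a b w1 τ1 X - s * tjR a b J' X := fun X => by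
      rw [tj_sl_lin a b w1 _ τ1 _ 4 (-s) J' (fun e => by ring) (by ring)]; ring
    by_cases hviol : ∀ X, tjOdd t X → 0 ≤ 4 * tjSl a b w1 τ1 X - s * tjR a b J' X
    · have sl2T : ∀ X, tjOdd t X → 𝒯 X → 4 * tjSl a b w1 τ1 X - s * tjR a b J' X = 0 :=
        fun X hX hT => by rw [sl1T X hX hT, hTr J' hJ' X hX hT]; ring
      have w20 : ∀ e, e ∉ S → 4 * w1 e - s * tjInd J' e = 0 := fun e he => by
        rw [w10 e he, hind0 J' hJ' e he]; ring
      have := hHI (fun e => 4 * w1 e - s * tjInd J' e) (4 * τ1 - s)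
        (tj_feas_of (U0 := U0) (fun e => by
          by_cases he : e ∈ S
          · have h1 := w1M e he
            have h2 : tjInd J' e ≤ 1 := by unfold tjInd; split_ifs <;> norm_num
            have h3 : s * tjInd J' e ≤ s * 1 := mul_le_mul_of_nonneg_left h2 hs0
            show 0 ≤ 4 * w1 e - s * tjInd J' e
            linarith
          · exact (w20 e he).ge)
          (fun X hX => by rw [sl2]; exact hviol X hX) (by rw [sl2]; exact sl2T U0 hU0 hU0'))
        w20 (fun X hX hT => by rw [sl2]; exact sl2T X hX hT)
        (Or.inr ⟨U, hU1, hU2, by rw [sl2, hcr, hsc]; ring⟩)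
      exact this.peel hJ'.join hs0 (k := 2) (fun e => by ring) (by ring)
    · push Not at hviol
      obtain ⟨X1, hX1, hv1⟩ := hviol
      have hrX1 : 0 < tjR a b J' X1 := by
        have h1 := hJ'.r_nonneg hX1
        have h2 := sl1nn X1 hX1
        rcases h1.lt_or_eq with h | h
        · exact h
        · rw [← h] at hv1; linarith
      obtain ⟨X0, hX0, hmin⟩ := tj_minratio
        (Finset.univ.filter (fun X => tjOdd t X ∧ 0 < tjR a b J' X))
        ⟨X1, by simp [hX1, hrX1]⟩ (tjSl a b w1 τ1) (tjR a b J') (fun X hX => by simp at hX; exact hX.2)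
      simp only [Finset.mem_filter, Finset.mem_univ, true_and] at hX0 hmin
      have hq1 := hX0.2
      have hp1 := sl1nn X0 hX0.1
      have h4 : 4 * tjSl a b w1 τ1 X0 < s * tjR a b J' X0 := by
        have h1 := hmin X1 ⟨hX1, hrX1⟩
        have h2 : 4 * tjSl a b w1 τ1 X1 < s * tjR a b J' X1 := by linarith
        have h3 := mul_lt_mul_of_pos_right h2 hq1
        have h5 : (4 * tjSl a b w1 τ1 X0) * tjR a b J' X1 <
            (s * tjR a b J' X0) * tjR a b J' X1 := by linarith
        exact lt_of_mul_lt_mul_right h5 hrX1.le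
      refine ih w1 τ1 J' (tjSl a b w1 τ1 X0) (tjR a b J' X0) (D.erase U) ?_ hcls1 hJ' hp1 hq1
        ?_ ?_ ?_ ⟨X0, hX0.1, fun hT => ?_, by ring⟩
      · rw [Finset.card_erase_of_mem (hmem U hU1 hU2 hU3)]; omega
      · intro e he
        have h1 := w1M e he
        have h2 : tjInd J' e ≤ 1 := by unfold tjInd; split_ifs <;> norm_num
        have h3 := mul_le_mul_of_nonneg_left h2 hp1
        have h5 : tjR a b J' X0 * s ≤ tjR a b J' X0 * w1 e :=
          mul_le_mul_of_nonneg_left (by omega) hq1.le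
        linarith
      · intro X hX
        have h1 := sl1nn X hX
        rcases (hJ'.r_nonneg hX).lt_or_eq with h | h
        · have := hmin X ⟨hX, h⟩; linarith
        · rw [← h]
          have := mul_nonneg hq1.le h1
          linarith
      · intro X hX hT hXe
        refine Finset.mem_erase.mpr ⟨?_, hmem X hX hT ?_⟩
        · rintro rfl
          rw [hcr] at hXe
          have h1 := mul_lt_mul_of_pos_right h4 hc0
          have h2 : s * tjR a b J' X0 * c = 4 * (tjR a b J' X0 * tjSl a b w1 τ1 X) := by
            linear_combination tjR a b J' X0 * hsc
          rw [h2, hXe] at h1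
          linarith
        · by_contra hne
          have h1 := hsl X hX
          have h2 : 1 ≤ q * tjSl a b w τ X - p * tjR a b J X := by
            rcases h1.lt_or_eq with h | h
            · omega
            · exact absurd (by linarith) hne
          have h3 : (2 : ℤ) ^ K * 1 ≤ 2 ^ K * (q * tjSl a b w τ X - p * tjR a b J X) :=
            mul_le_mul_of_nonneg_left h2 hK0.le
          have h5 := mul_nonneg hr0 (hJ.r_nonneg hX)
          have h6 := qsl1 X
          have h7 : M ≤ tjSl a b w1 τ1 X := le_of_mul_le_mul_left (by linarith) hq
          have h8 : tjSl a b w1 τ1 X0 * tjR a b J' X ≤ tjSl a b w1 τ1 X0 * N :=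
            mul_le_mul_of_nonneg_left (hrN _ _) hp1
          have h9 : 4 * tjSl a b w1 τ1 X0 * N ≤ s * tjR a b J' X0 * N :=
            mul_le_mul_of_nonneg_right h4.le hN0
          have h10 : s * (tjR a b J' X0 * N) ≤ 2 * N * (tjR a b J' X0 * N) :=
            mul_le_mul_of_nonneg_right hsN (mul_nonneg hq1.le hN0)
          have h11 : tjR a b J' X0 * M ≤ tjR a b J' X0 * tjSl a b w1 τ1 X :=
            mul_le_mul_of_nonneg_left h7 hq1.le
          have h12 : tjR a b J' X0 * (4 * M) ≤ tjR a b J' X0 * (2 * N ^ 2) := by linarith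
          have h13 := le_of_mul_le_mul_left h12 hq1
          rw [hM] at h13
          nlinarith
      · have := hTr J' hJ' X0 hX0.1 hT
        omega

end TJClaim

section TJMain

set_option linter.unusedSectionVars false

variable {E V : Type} [Fintype E] [DecidableEq E] [Fintype V] [DecidableEq V]

theorem tjDP.mono {P : Finset E → Prop} {n : ℤ} {u v : E → ℤ} (h1 : tjDP P u n)
    (h : ∀ e, u e ≤ v e) : tjDP P v n := by
  obtain ⟨k, h1⟩ := h1
  exact ⟨k, h1.mono fun e => mul_le_mul_of_nonneg_left (h e) (by positivity)⟩

theorem tj_inner (hOut : tjOut E (Fintype.card V)) (a b : E → V) (t : V → ZMod 2) :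
    ∀ (n : ℕ) (w : E → ℤ) (τ : ℤ) (D : Finset (Finset V)),
      (∀ U, U ∈ D ↔ tjOdd t U ∧ tjSl a b w τ U ≠ 0) → (tjSupp w).card + D.card ≤ n →
      tjFeas a b t w τ → tjDP (tjJoin a b t) w τ := by
  classical
  intro n
  induction n using Nat.strong_induction_on with
  | _ n IH =>
  intro w τ D hD hn hfe
  by_cases hτ : τ = 0
  · subst hτ
    exact ⟨0, Empty, inferInstance, fun x => x.elim, by simp, fun x => x.elim,
      fun e => by simpa using hfe.1 e⟩
  have hτ0 : 0 < τ := by have := hfe.2.1; omega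
  by_cases hno : ∀ U, ¬ tjOdd t U
  · have ht : ∀ v, t v = 0 := fun v => by
      have := hno {v}
      simp only [tjOdd, Finset.sum_singleton] at this
      exact (tj_zmod2 (t v)).resolve_right this
    have hj : tjJoin a b t ∅ := fun v => by simp [tjSg, ht]
    have := (tjDP.copies hj τ.toNat).mono (v := w) (fun e => by simp [tjInd, hfe.1 e])
    rwa [Int.toNat_of_nonneg hτ0.le] at this
  push Not at hno
  obtain ⟨U1, hU1⟩ := hno
  by_cases htight : ∀ U, tjOdd t U → tjSl a b w τ U ≠ 0
  · -- no tight set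
    obtain ⟨X0, hX0, hmin⟩ := Finset.exists_min_image
      (Finset.univ.filter (fun U => tjOdd t U)) (fun U => ∑ e ∈ tjCut a b U, w e) ⟨U1, by simp [hU1]⟩
    simp only [Finset.mem_filter, Finset.mem_univ, true_and] at hX0 hmin
    have hle := hfe.2.2 X0 hX0
    refine tjDP.sub (n := ∑ e ∈ tjCut a b X0, w e) ?_ hτ0.le hle
    have hDX : X0 ∈ D := (hD X0).mpr ⟨hX0, htight X0 hX0⟩
    have hlt : (D.filter (fun U => tjSl a b w (∑ e ∈ tjCut a b X0, w e) U ≠ 0)).card < D.card := by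
      apply Finset.card_lt_card
      refine ⟨Finset.filter_subset _ _, fun h => ?_⟩
      have := h hDX
      rw [Finset.mem_filter] at this
      exact this.2 (by simp [tjSl])
    refine IH _ (by omega) w _ (D.filter (fun U => tjSl a b w (∑ e ∈ tjCut a b X0, w e) U ≠ 0))
      (fun U => ?_) le_rfl ⟨hfe.1, hfe.2.1.trans hle, hmin⟩
    rw [Finset.mem_filter, hD]
    constructor
    · rintro ⟨h1, h2⟩; exact ⟨h1.1, h2⟩
    · rintro ⟨h1, h2⟩; exact ⟨⟨h1, htight U h1⟩, h2⟩
  push Not at htight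
  obtain ⟨U0, hU0, hU0'⟩ := htight
  by_cases hnt : ∃ U, tjOdd t U ∧ tjSl a b w τ U = 0 ∧ 2 ≤ U.card ∧ 2 ≤ Uᶜ.card
  · obtain ⟨U, h1, h2, h3, h4⟩ := hnt
    exact tj_step0 hOut hfe U h3 h4 h1 h2
  have hsum : ∑ v, t v = 0 := by
    rcases tj_zmod2 (∑ v, t v) with h | h
    · exact h
    · have h1 := hfe.2.2 Finset.univ h
      have h2 : tjCut a b Finset.univ = ∅ := by ext e; simp [tj_mem_cut]
      rw [h2] at h1; simp at h1; omega
  have hone : ∀ U, tjOdd t U → tjSl a b w τ U = 0 →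
      ∃ v, tjTv a b t w τ v ∧ tjCut a b U = tjCut a b {v} := by
    intro U hU hs
    have hUc := tj_odd_compl hsum hU
    have hne : ∀ X : Finset V, tjOdd t X → X.card ≠ 0 := by
      intro X hX h0
      rw [Finset.card_eq_zero.mp h0] at hX
      simp [tjOdd] at hX
    have n1 := hne U hU
    have n2 := hne Uᶜ hUc
    have hor : U.card = 1 ∨ Uᶜ.card = 1 := by
      by_contra hcon
      exact hnt ⟨U, hU, hs, by omega, by omega⟩
    rcases hor with h | h
    · obtain ⟨v, rfl⟩ := Finset.card_eq_one.mp h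
      exact ⟨v, ⟨hU, hs⟩, rfl⟩
    · obtain ⟨v, hv⟩ := Finset.card_eq_one.mp h
      rw [hv] at hUc
      have hcc : tjCut a b U = tjCut a b {v} := by rw [← hv, tj_cut_compl]
      refine ⟨v, ⟨hUc, ?_⟩, hcc⟩
      unfold tjSl at hs ⊢
      rwa [← hcc]
  obtain ⟨x, hx, -⟩ := hone U0 hU0 hU0'
  obtain ⟨J, hJ⟩ := tj_step2 hOut hfe hτ0 hx
  -- inner hypothesis
  have hHI : tjHI a b t (tjSupp w) (fun U => tjSl a b w τ U = 0) := by
    intro w' τ' hf' hz hT hnew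
    have hs : tjSupp w' ⊆ tjSupp w := by
      intro e he
      by_contra hne
      simp only [tjSupp, Finset.mem_filter, Finset.mem_univ, true_and] at he
      exact he (hz e hne)
    have hd : D.filter (fun U => tjSl a b w' τ' U ≠ 0) ⊆ D := Finset.filter_subset _ _
    have c1 := Finset.card_le_card hs
    have c2 := Finset.card_le_card hd
    have hlt : (tjSupp w').card + (D.filter (fun U => tjSl a b w' τ' U ≠ 0)).card <
        (tjSupp w).card + D.card := by
      rcases hnew with ⟨e, he, he'⟩ | ⟨U, h1, h2, h3⟩
      · have : (tjSupp w').card < (tjSupp w).card := by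
          apply Finset.card_lt_card
          refine ⟨hs, fun h => ?_⟩
          have := h he
          simp [tjSupp, he'] at this
        omega
      · have : (D.filter (fun U => tjSl a b w' τ' U ≠ 0)).card < D.card := by
          apply Finset.card_lt_card
          refine ⟨hd, fun h => ?_⟩
          have := h ((hD U).mpr ⟨h1, h2⟩)
          simp [h3] at this
        omega
    refine IH _ (by omega) w' τ' (D.filter (fun U => tjSl a b w' τ' U ≠ 0)) (fun U => ?_) le_rfl hf'
    rw [Finset.mem_filter, hD]
    constructor
    · rintro ⟨h1, h2⟩; exact ⟨h1.1, h2⟩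
    · rintro ⟨h1, h2⟩; exact ⟨⟨h1, fun h => h2 (hT U h1 h)⟩, h2⟩
  have hTr : ∀ J, tjTJ a b t (tjSupp w) (tjTv a b t w τ) J → ∀ U, tjOdd t U →
      tjSl a b w τ U = 0 → tjR a b J U = 0 := by
    intro J hJ U hU hs
    obtain ⟨v, hv, hc⟩ := hone U hU hs
    unfold tjR
    rw [hc, (hJ.2 v).2 hv]; norm_num
  have hcls : tjCls a b t (tjSupp w) (fun U => tjSl a b w τ U = 0) w τ :=
    ⟨hfe, fun e => by simp [tjSupp], fun U _ => Iff.rfl⟩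
  have hJne : J.Nonempty := by
    obtain ⟨e, he⟩ := Finset.card_eq_one.mp ((hJ.2 x).2 hx)
    have : e ∈ J ∩ tjCut a b {x} := by rw [he]; simp
    exact ⟨e, (Finset.mem_inter.mp this).1⟩
  obtain ⟨e1, he1, hemin⟩ := Finset.exists_min_image J w hJne
  have hw1 : 0 ≤ w e1 := hfe.1 e1
  have hle1 : ∀ e, tjInd J e ≤ 1 := fun e => by unfold tjInd; split_ifs <;> norm_num
  have hSpos : ∀ e ∈ tjSupp w, 0 < w e := by
    intro e he
    simp only [tjSupp, Finset.mem_filter, Finset.mem_univ, true_and] at he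
    have := hfe.1 e
    omega
  have hS0 : ∀ e, e ∉ tjSupp w → w e = 0 ∧ tjInd J e = 0 := by
    intro e he
    refine ⟨by simpa [tjSupp] using he, ?_⟩
    have : e ∉ J := fun h => he (hJ.1 h)
    simp [tjInd, this]
  have sl' : ∀ X, tjSl a b (fun e => w e - w e1 * tjInd J e) (τ - w e1) X =
      tjSl a b w τ X - w e1 * tjR a b J X := fun X => by
    rw [tj_sl_lin a b w _ τ _ 1 (-w e1) J (fun e => by ring) (by ring)]; ring
  by_cases hviol : ∀ X, tjOdd t X → 0 ≤ tjSl a b w τ X - w e1 * tjR a b J X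
  · have hT : ∀ X, tjOdd t X → tjSl a b w τ X = 0 →
        tjSl a b (fun e => w e - w e1 * tjInd J e) (τ - w e1) X = 0 := fun X hX hs => by
      rw [sl', hs, hTr J hJ X hX hs]; ring
    have := hHI (fun e => w e - w e1 * tjInd J e) (τ - w e1)
      (tj_feas_of (U0 := U0) (fun e => by
        by_cases he : e ∈ J
        · have := hemin e he
          simp [tjInd, he, this]
        · simp [tjInd, he, hfe.1 e])
        (fun X hX => by rw [sl']; exact hviol X hX) (hT U0 hU0 hU0'))
      (fun e he => by
        obtain ⟨h1, h2⟩ := hS0 e he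
        show w e - w e1 * tjInd J e = 0
        rw [h1, h2]; ring) hT
      (Or.inl ⟨e1, hJ.1 he1, by simp [tjInd, he1]⟩)
    exact this.peel hJ.join hw1 (k := 0) (fun e => by ring) (by ring)
  · push Not at hviol
    obtain ⟨X1, hX1, hv1⟩ := hviol
    have hrX1 : 0 < tjR a b J X1 := by
      have h1 := hJ.r_nonneg hX1
      have h2 := hfe.sl hX1
      rcases h1.lt_or_eq with h | h
      · exact h
      · rw [← h] at hv1; linarith
    obtain ⟨X0, hX0, hmin⟩ := tj_minratio
      (Finset.univ.filter (fun X => tjOdd t X ∧ 0 < tjR a b J X))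
      ⟨X1, by simp [hX1, hrX1]⟩ (tjSl a b w τ) (tjR a b J) (fun X hX => by simp at hX; exact hX.2)
    simp only [Finset.mem_filter, Finset.mem_univ, true_and] at hX0 hmin
    have hq1 := hX0.2
    have hp1 := hfe.sl hX0.1
    have h4 : tjSl a b w τ X0 < w e1 * tjR a b J X0 := by
      have h1 := hmin X1 ⟨hX1, hrX1⟩
      have h2 : tjSl a b w τ X1 < w e1 * tjR a b J X1 := by linarith
      have h3 := mul_lt_mul_of_pos_right h2 hq1
      have h5 : (tjSl a b w τ X0) * tjR a b J X1 <
          (w e1 * tjR a b J X0) * tjR a b J X1 := by linarith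
      exact lt_of_mul_lt_mul_right h5 hrX1.le
    refine tj_claim (𝒯 := fun U => tjSl a b w τ U = 0) (Tt := tjTv a b t w τ) (fun v hv => hv) hHI hU0 hU0' hTr
      (Finset.univ : Finset (Finset V)).card w τ J
      (tjSl a b w τ X0) (tjR a b J X0) Finset.univ le_rfl hcls hJ hp1 hq1 ?_ ?_
      (fun _ _ _ _ => Finset.mem_univ _) ⟨X0, hX0.1, fun hT => ?_, by ring⟩
    · intro e he
      by_cases heJ : e ∈ J
      · have h1 := mul_le_mul_of_nonneg_left (hemin e heJ) hq1.le
        simp only [tjInd, heJ, if_true]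
        linarith
      · have := mul_pos hq1 (hSpos e he)
        simp only [tjInd, heJ, if_false]
        linarith
    · intro X hX
      have h1 := hfe.sl hX
      rcases (hJ.r_nonneg hX).lt_or_eq with h | h
      · have := hmin X ⟨hX, h⟩; linarith
      · rw [← h]
        have := mul_nonneg hq1.le h1
        linarith
    · have := hTr J hJ X0 hX0.1 hT
      omega

theorem tj_main (n : ℕ) : tjOut E n := by
  classical
  induction n with
  | zero => intro V' _ _ a b t w τ h; omega
  | succ n ih =>
    intro V' _ _ a b t w τ hc hfe
    have hOut : tjOut E (Fintype.card V') := by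
      intro V'' _ _ a b t w τ h hf
      exact ih V'' a b t w τ (by omega) hf
    exact tj_inner hOut a b t _ w τ
      (Finset.univ.filter (fun U => tjOdd t U ∧ tjSl a b w τ U ≠ 0)) (fun U => by simp) le_rfl hfe

theorem tj_pack (a b : E → V) (t : V → ZMod 2) (w : E → ℤ) (τ : ℤ) (h : tjFeas a b t w τ) :
    tjDP (tjJoin a b t) w τ :=
  tj_main (Fintype.card V + 1) V a b t w τ (by omega) h

end TJMain


/-- For a finite (loopless) graph `G = (V, E)` and a nonempty `T ⊆ V` of
even cardinality, the system `x(J) ≥ 1` for all `T`-joins `J`, `x ≥ 0` is totally dual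
dyadic: whenever the primal `min {wᵀx : x(J) ≥ 1 ∀ T-joins J, x ≥ 0}` (`w` integral) has an
optimal solution, the dual has a dyadic optimal solution. -/
theorem tjoin_system_totally_dual_dyadic {V E : Type} [Fintype V] [Fintype E]
    (ends : E → Sym2 V) (hloopless : ∀ e, ¬ (ends e).IsDiag)
    (T : Finset V) (hT : T.Nonempty) (hTeven : Even T.card)
    (w : E → ℤ)
    (hopt : ∃ x : E → ℝ,
      ((∀ e, 0 ≤ x e) ∧ ∀ J : Finset E, IsTJoin ends T J → 1 ≤ ∑ e ∈ J, x e) ∧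
      ∀ x' : E → ℝ,
        ((∀ e, 0 ≤ x' e) ∧ ∀ J : Finset E, IsTJoin ends T J → 1 ≤ ∑ e ∈ J, x' e) →
        ∑ e, (w e : ℝ) * x e ≤ ∑ e, (w e : ℝ) * x' e) :
    ∃ y : {J : Finset E // IsTJoin ends T J} → ℝ,
      ((∀ J, 0 ≤ y J) ∧
        ∀ e, ∑ J : {J : Finset E // IsTJoin ends T J}, (if e ∈ J.1 then y J else 0) ≤
          (w e : ℝ)) ∧
      (∀ y' : {J : Finset E // IsTJoin ends T J} → ℝ,
        ((∀ J, 0 ≤ y' J) ∧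
          ∀ e, ∑ J : {J : Finset E // IsTJoin ends T J}, (if e ∈ J.1 then y' J else 0) ≤
            (w e : ℝ)) →
        ∑ J, y' J ≤ ∑ J, y J) ∧
      (∀ J, IsDyadic (y J)) := by
  -- nonnegativity of the weights
  have hw : ∀ e, 0 ≤ w e := by
    intro e0
    by_contra hneg
    obtain ⟨x, ⟨hx1, hx2⟩, hx3⟩ := hopt
    have h := hx3 (fun e => x e + if e = e0 then 1 else 0) ⟨fun e => ?_, fun J hJ => ?_⟩
    · simp only [mul_add, Finset.sum_add_distrib, mul_ite, mul_one, mul_zero, Finset.sum_ite_eq',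
        Finset.mem_univ, if_true] at h
      have h1 : (0 : ℝ) ≤ (w e0 : ℝ) := by linarith
      exact hneg (by exact_mod_cast h1)
    · have := hx1 e
      show (0 : ℝ) ≤ x e + if e = e0 then 1 else 0
      split_ifs <;> linarith
    · refine (hx2 J hJ).trans (Finset.sum_le_sum fun e _ => ?_)
      split_ifs <;> linarith
  -- endpoints
  have hends : ∀ e, ∃ p : V × V, ends e = s(p.1, p.2) := fun e => by
    obtain ⟨p, hp⟩ := Quot.exists_rep (ends e)
    exact ⟨p, hp.symm⟩
  choose ep hep using hends
  obtain ⟨a, ha⟩ : ∃ a : E → V, ∀ e, a e = (ep e).1 := ⟨_, fun _ => rfl⟩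
  obtain ⟨b, hb⟩ : ∃ b : E → V, ∀ e, b e = (ep e).2 := ⟨_, fun _ => rfl⟩
  have hab : ∀ e, a e ≠ b e := by
    intro e h
    apply hloopless e
    rw [hep, Sym2.mk_isDiag_iff, ← ha, ← hb]
    exact h
  have hmem : ∀ e v, v ∈ ends e ↔ e ∈ tjCut a b {v} := by
    intro e v
    rw [hep, Sym2.mem_iff, ← ha, ← hb, tj_mem_cut]
    simp only [Finset.mem_singleton]
    have := hab e
    constructor
    · rintro (rfl | rfl)
      · intro h; exact this (h.mp rfl).symm
      · intro h; exact this (h.mpr rfl)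
    · intro h
      by_contra hcon
      push Not at hcon
      exact h ⟨fun q => absurd q.symm hcon.1, fun q => absurd q.symm hcon.2⟩
  obtain ⟨t, ht⟩ : ∃ t : V → ZMod 2, ∀ v, t v = if v ∈ T then 1 else 0 := ⟨_, fun _ => rfl⟩
  have hjoin : ∀ J, IsTJoin ends T J ↔ tjJoin a b t J := by
    intro J
    unfold IsTJoin tjJoin
    refine forall_congr' fun v => ?_
    have hset : Finset.univ.filter (fun e => e ∈ J ∧ v ∈ ends e) = J ∩ tjCut a b {v} := by
      ext e; simp [hmem]
    rw [hset, tj_sg_card, ht]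
    by_cases hv : v ∈ T
    · rw [if_pos hv, ZMod.natCast_eq_one_iff_odd]
      simp [hv]
    · rw [if_neg hv, ZMod.natCast_eq_zero_iff_even, ← Nat.not_odd_iff_even]
      simp [hv]
  -- minimum cut
  obtain ⟨v0, hv0⟩ := hT
  have hodd0 : tjOdd t {v0} := by simp [tjOdd, ht, hv0]
  obtain ⟨U, hU, hmin⟩ := Finset.exists_min_image
    (Finset.univ.filter (fun U => tjOdd t U)) (fun U => ∑ e ∈ tjCut a b U, w e)
    ⟨{v0}, by simp [hodd0]⟩
  simp only [Finset.mem_filter, Finset.mem_univ, true_and] at hU hmin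
  obtain ⟨k, ι, _, J, j1, j2, j3⟩ := tj_pack a b t w (∑ e ∈ tjCut a b U, w e)
    ⟨hw, Finset.sum_nonneg fun e _ => hw e, hmin⟩
  have hpow : (0 : ℝ) < 2 ^ k := by positivity
  obtain ⟨Jt, hJt⟩ : ∃ Jt : ι → {J : Finset E // IsTJoin ends T J}, ∀ i, (Jt i).1 = J i :=
    ⟨fun i => ⟨J i, (hjoin _).mpr (j2 i)⟩, fun _ => rfl⟩
  obtain ⟨y, hy⟩ : ∃ y : {J : Finset E // IsTJoin ends T J} → ℝ,
      ∀ J, y J = (∑ i, if Jt i = J then (1 : ℝ) else 0) / 2 ^ k := ⟨_, fun _ => rfl⟩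
  have hF : ∀ F : {J : Finset E // IsTJoin ends T J} → ℝ,
      ∑ J, F J * y J = (∑ i, F (Jt i)) / 2 ^ k := by
    intro F
    simp only [hy, ← mul_div_assoc, ← Finset.sum_div, Finset.mul_sum, mul_ite, mul_one, mul_zero]
    rw [Finset.sum_comm]
    simp
  have htot : ∑ J, y J = ((∑ e ∈ tjCut a b U, w e : ℤ) : ℝ) := by
    have h1 := hF (fun _ => 1)
    simp only [one_mul, Finset.sum_const, Finset.card_univ, nsmul_eq_mul, mul_one] at h1
    rw [h1, div_eq_iff hpow.ne', mul_comm]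
    exact_mod_cast j1
  refine ⟨y, ⟨fun J => ?_, fun e => ?_⟩, fun y' hy' => ?_, fun J => ?_⟩
  · rw [hy]
    exact div_nonneg (Finset.sum_nonneg fun i _ => by split_ifs <;> norm_num) hpow.le
  · have h1 := hF (fun J => if e ∈ J.1 then 1 else 0)
    simp only [ite_mul, one_mul, zero_mul] at h1
    rw [h1, div_le_iff₀ hpow, mul_comm]
    have h2 : ((∑ i, tjInd (J i) e : ℤ) : ℝ) ≤ ((2 ^ k * w e : ℤ) : ℝ) := by exact_mod_cast j3 e
    simp only [tjInd] at h2
    push_cast at h2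
    simpa only [hJt] using h2
  · rw [htot]
    calc ∑ J, y' J ≤ ∑ J : {J : Finset E // IsTJoin ends T J},
          ∑ e ∈ tjCut a b U, (if e ∈ J.1 then y' J else 0) := by
          refine Finset.sum_le_sum fun J _ => ?_
          have h1 := ((hjoin _).mp J.2).pos hU
          rw [← Finset.sum_filter, Finset.sum_const, nsmul_eq_mul, Finset.filter_mem_eq_inter,
            Finset.inter_comm]
          have h2 : (1 : ℝ) ≤ ((J.1 ∩ tjCut a b U).card : ℝ) := by exact_mod_cast h1
          have h3 := mul_le_mul_of_nonneg_right h2 (hy'.1 J)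
          linarith
      _ = ∑ e ∈ tjCut a b U, ∑ J : {J : Finset E // IsTJoin ends T J},
          (if e ∈ J.1 then y' J else 0) := Finset.sum_comm
      _ ≤ ∑ e ∈ tjCut a b U, (w e : ℝ) := Finset.sum_le_sum fun e _ => hy'.2 e
      _ = _ := by push_cast; rfl
  · refine ⟨∑ i, if Jt i = J then 1 else 0, k, ?_⟩
    rw [hy]
    push_cast
    rfl
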